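/- Let ω ∈ 𝒲 with associated functions φ and τ, let p ∈ (0,1), and let g ∈ L²_ω be such that the Hankel operator H_g extends to a bounded operator from A²_ω to L²_ω. Suppose there exist δ ∈ (0, m_τ) and a decomposition g = g₁ + g₂ with g₂ ∈ C¹(𝔻) such that for every τ-covering {D(δτ(z_j))} of 𝔻 both ∑_j ( (1/|D(δτ(z_j))|) ∫_{D(δτ(z_j))} |g₁|² dA )^{p/2} < ∞ and the same sum with ∂̄g₂/(Δφ)^{1/2} in place of g₁ is finite. Then H_g belongs to the Schatten class S^p of operators from A²_ω to L²_ω. -/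

import Mathlib

open MeasureTheory Filter Set
open scoped ENNReal ComplexOrder

noncomputable section

/-- The open unit disc in `ℂ`. -/
def unitDisc : Set ℂ := Metric.ball (0 : ℂ) 1

/-- Normalized area Lebesgue measure `dA = dx dy / π` on `ℂ`. -/
def dA : Measure ℂ := (ENNReal.ofReal Real.pi)⁻¹ • (volume : Measure ℂ)

/-- The weighted measure `ω dA` on the unit disc. -/
def muW (ω : ℂ → ℝ) : Measure ℂ :=
  (dA.restrict unitDisc).withDensity fun z => ENNReal.ofReal (ω z)

/-- The radial extension to `𝔻` of a function of `r ∈ [0,1)`. -/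
def radialize (τ : ℝ → ℝ) : ℂ → ℝ := fun z => τ ‖z‖

/-- The class `𝓛`, with constants `c₁, c₂`. -/
structure IsClassL (τC : ℂ → ℝ) (c₁ c₂ : ℝ) : Prop where
  c₁_pos : 0 < c₁
  c₂_pos : 0 < c₂
  pos : ∀ z ∈ unitDisc, 0 < τC z
  upper : ∀ z ∈ unitDisc, τC z ≤ c₁ * (1 - ‖z‖)
  lip : ∀ z ∈ unitDisc, ∀ ζ ∈ unitDisc, |τC z - τC ζ| ≤ c₂ * ‖z - ζ‖

/-- `m_τ = min(1, c₁⁻¹, c₂⁻¹)/4`. -/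
def mTau (c₁ c₂ : ℝ) : ℝ := min 1 (min c₁⁻¹ c₂⁻¹) / 4

/-- The Laplacian `Δφ = φ_xx + φ_yy` of a function `φ : ℂ → ℝ`. -/
def laplacian (φ : ℂ → ℝ) (z : ℂ) : ℝ :=
  fderiv ℝ (fun w => fderiv ℝ φ w 1) z 1 +
    fderiv ℝ (fun w => fderiv ℝ φ w Complex.I) z Complex.I

/-- The Wirtinger derivative `∂̄g = (g_x + i g_y)/2` of `g : ℂ → ℂ`. -/
def dbar (g : ℂ → ℂ) (z : ℂ) : ℂ :=
  (fderiv ℝ g z 1 + Complex.I * fderiv ℝ g z Complex.I) / 2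

/-- The class `𝒲` of weights `ω = e^{-2φ}` with associated radial profile `τ`. -/
structure IsClassW (ω φ : ℂ → ℝ) (τ : ℝ → ℝ) : Prop where
  pos : ∀ z ∈ unitDisc, 0 < ω z
  omega_eq : ∀ z ∈ unitDisc, ω z = Real.exp (-(2 * φ z))
  integrable : ∫⁻ z in unitDisc, ENNReal.ofReal (ω z) ∂dA < ⊤
  radial : ∀ z ∈ unitDisc, ∀ ζ ∈ unitDisc, ‖z‖ = ‖ζ‖ → φ z = φ ζ
  smooth : ContDiffOn ℝ 2 φ unitDisc
  lap_pos : ∀ z ∈ unitDisc, 0 < laplacian φ z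
  tau_pos : ∀ r ∈ Set.Ico (0 : ℝ) 1, 0 < τ r
  tau_anti : AntitoneOn τ (Set.Ico 0 1)
  tau_lim : Tendsto τ (nhdsWithin 1 (Set.Iio 1)) (nhds 0)
  tau_diff : ∀ r ∈ Set.Ico (0 : ℝ) 1, DifferentiableAt ℝ τ r
  tau_deriv_lim : Tendsto (deriv τ) (nhdsWithin 1 (Set.Iio 1)) (nhds 0)
  comp : ∃ C : ℝ, 1 ≤ C ∧ ∀ z ∈ unitDisc,
    τ ‖z‖ / C ≤ (laplacian φ z) ^ (-(1 / 2 : ℝ)) ∧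
      (laplacian φ z) ^ (-(1 / 2 : ℝ)) ≤ C * τ ‖z‖
  extra : (∃ C > (0 : ℝ), ∃ r₀ ∈ Set.Ico (0 : ℝ) 1,
      MonotoneOn (fun r => τ r * (1 - r) ^ C) (Set.Ico r₀ 1)) ∨
    Tendsto (fun r => deriv τ r * Real.log (1 / τ r)) (nhdsWithin 1 (Set.Iio 1)) (nhds 0)

/-- A `(δ,τ)`-lattice of the unit disc. -/
structure IsLattice (τC : ℂ → ℝ) (δ : ℝ) (z : ℕ → ℂ) : Prop where
  mem : ∀ j, z j ∈ unitDisc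
  sep : ∀ j k, j ≠ k → z j ∉ Metric.ball (z k) (δ * τC (z k))
  covers : ∀ w ∈ unitDisc, ∃ j, w ∈ Metric.ball (z j) (δ * τC (z j))
  mult : ∃ N : ℕ, ∀ w ∈ unitDisc,
    ({j : ℕ | w ∈ Metric.ball (z j) (3 * (δ * τC (z j)))}).ncard ≤ N

/-- The distance `d_τ(z,ζ) = |z-ζ| / min(τ(z),τ(ζ))`. -/
def dTau (τC : ℂ → ℝ) (z ζ : ℂ) : ℝ := ‖z - ζ‖ / min (τC z) (τC ζ)

/-- `(1/|D(δτ(z))|) ∫_{D(δτ(z))} |u|² dA`, valued in `ℝ≥0∞`. -/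
def localMeanE (τC : ℂ → ℝ) (δ : ℝ) (u : ℂ → ℂ) (z : ℂ) : ℝ≥0∞ :=
  (ENNReal.ofReal ((δ * τC z) ^ 2))⁻¹ *
    ∫⁻ w in Metric.ball z (δ * τC z), ENNReal.ofReal (‖u w‖ ^ 2) ∂dA

/-- `F_δ(z)² = inf over h analytic in D(δτ(z)) of the mean square of g - h`. -/
def FdeltaSqE (τC : ℂ → ℝ) (δ : ℝ) (g : ℂ → ℂ) (z : ℂ) : ℝ≥0∞ :=
  ⨅ (h : ℂ → ℂ) (_ : DifferentiableOn ℂ h (Metric.ball z (δ * τC z))),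
    localMeanE τC δ (fun w => g w - h w) z

/-- The submodule of `L²_ω` of elements with a representative analytic on `𝔻`. -/
def bergmanSubmodule (ω : ℂ → ℝ) : Submodule ℂ (Lp ℂ 2 (muW ω)) where
  carrier := {f | ∃ F : ℂ → ℂ, DifferentiableOn ℂ F unitDisc ∧ (f : ℂ → ℂ) =ᵐ[muW ω] F}
  zero_mem' := ⟨0, differentiableOn_const 0, Lp.coeFn_zero ℂ 2 (muW ω)⟩
  add_mem' := by
    rintro a b ⟨F, hF, ha⟩ ⟨G, hG, hb⟩
    refine ⟨F + G, hF.add hG, ?_⟩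
    filter_upwards [Lp.coeFn_add a b, ha, hb] with w h1 h2 h3
    rw [h1]; simp only [Pi.add_apply, h2, h3]
  smul_mem' := by
    rintro c a ⟨F, hF, ha⟩
    refine ⟨c • F, hF.const_smul c, ?_⟩
    filter_upwards [Lp.coeFn_smul c a, ha] with w h1 h2
    rw [h1]; simp only [Pi.smul_apply, h2]

/-- The Bergman space `A²_ω`, a closed subspace of `L²_ω`. -/
def bergmanH (ω : ℂ → ℝ) : Submodule ℂ (Lp ℂ 2 (muW ω)) :=
  (bergmanSubmodule ω).topologicalClosure

instance (ω : ℂ → ℝ) : CompleteSpace (bergmanH ω) :=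
  IsClosed.completeSpace_coe (hs := Submodule.isClosed_topologicalClosure _)

/-- The orthogonal (Bergman) projection of `L²_ω` onto `A²_ω`, valued in `A²_ω`. -/
def bergmanProjA (ω : ℂ → ℝ) : Lp ℂ 2 (muW ω) →L[ℂ] bergmanH ω :=
  Submodule.orthogonalProjectionOnto (bergmanH ω)

/-- The Bergman projection `P`, viewed as an operator of `L²_ω`. -/
def bergmanProj (ω : ℂ → ℝ) : Lp ℂ 2 (muW ω) →L[ℂ] Lp ℂ 2 (muW ω) :=
  (bergmanH ω).subtypeL.comp (bergmanProjA ω)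

/-- `T` is a bounded extension of the Hankel operator `H_g : f ↦ g f - P(g f)`,
defined on the bounded analytic functions `f ∈ H^∞`. -/
def IsHankelExtension (ω : ℂ → ℝ) (g : ℂ → ℂ)
    (T : bergmanH ω →L[ℂ] Lp ℂ 2 (muW ω)) : Prop :=
  ∀ (f : bergmanH ω) (F : ℂ → ℂ) (M : ℝ),
    DifferentiableOn ℂ F unitDisc →
    (∀ z ∈ unitDisc, ‖F z‖ ≤ M) →
    ((f : Lp ℂ 2 (muW ω)) : ℂ → ℂ) =ᵐ[muW ω] F →
    ∀ gF : Lp ℂ 2 (muW ω), ((gF : ℂ → ℂ) =ᵐ[muW ω] fun z => g z * F z) →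
    T f = gF - bergmanProj ω gF

/-- The `ν`-th singular number `s_ν(T) = inf{‖T - K‖ : rank K ≤ ν}`, `ν = 0, 1, 2, …`. -/
def singularNumber {E F : Type*} [NormedAddCommGroup E] [NormedSpace ℂ E]
    [NormedAddCommGroup F] [NormedSpace ℂ F] (T : E →L[ℂ] F) (ν : ℕ) : ℝ :=
  sInf {c : ℝ | ∃ K : E →L[ℂ] F,
    Module.rank ℂ (LinearMap.range (K : E →ₗ[ℂ] F)) ≤ (ν : Cardinal) ∧ c = ‖T - K‖}

/-- `‖T‖_{S^p}^p = ∑_ν s_ν(T)^p`. -/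
def schattenSum (p : ℝ) {E F : Type*} [NormedAddCommGroup E] [NormedSpace ℂ E]
    [NormedAddCommGroup F] [NormedSpace ℂ F] (T : E →L[ℂ] F) : ℝ :=
  ∑' ν : ℕ, singularNumber T ν ^ p

/-- Membership in the Schatten class `S^p`: `∑_ν s_ν(T)^p < ∞`. -/
def MemSchatten (p : ℝ) {E F : Type*} [NormedAddCommGroup E] [NormedSpace ℂ E]
    [NormedAddCommGroup F] [NormedSpace ℂ F] (T : E →L[ℂ] F) : Prop :=
  Summable fun ν : ℕ => singularNumber T ν ^ p

/-- A bounded operator has finite rank. -/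
def FiniteRank {E F : Type*} [NormedAddCommGroup E] [NormedSpace ℂ E]
    [NormedAddCommGroup F] [NormedSpace ℂ F] (T : E →L[ℂ] F) : Prop :=
  Module.rank ℂ (LinearMap.range (T : E →ₗ[ℂ] F)) < Cardinal.aleph0

/-- The decay estimate `|F(z)| ω(z)^{1/2} ≲ min(1, min(τ(α),τ(z))/|z-α|)^{3n}` on `𝔻`. -/
def TestDecay (τC ω : ℂ → ℝ) (C₀ : ℝ) (n : ℕ) (α : ℂ) (F : ℂ → ℂ) : Prop :=
  (∀ z ∈ unitDisc, ‖F z‖ * Real.sqrt (ω z) ≤ C₀) ∧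
    ∀ z ∈ unitDisc, z ≠ α → ‖F z‖ * Real.sqrt (ω z) ≤
      C₀ * (min (τC α) (τC z) / ‖z - α‖) ^ (3 * n)

/-- Multiplication of an `L²_ω` element by the indicator of a measurable set `D`. -/
def indLp (ω : ℂ → ℝ) (D : Set ℂ) (hD : MeasurableSet D) (f : Lp ℂ 2 (muW ω)) :
    Lp ℂ 2 (muW ω) :=
  MemLp.toLp (D.indicator f) ((Lp.memLp f).indicator hD)

/-- The subspace of `L²_ω` of elements vanishing a.e. off `D` with a representative
analytic on `D`;  its closure realizes `A²_ω(D)` inside `L²_ω`. -/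
def localBergmanSub (ω : ℂ → ℝ) (D : Set ℂ) : Submodule ℂ (Lp ℂ 2 (muW ω)) where
  carrier := {f | ((f : ℂ → ℂ) =ᵐ[(muW ω).restrict Dᶜ] 0) ∧
    ∃ h : ℂ → ℂ, DifferentiableOn ℂ h D ∧ (f : ℂ → ℂ) =ᵐ[(muW ω).restrict D] h}
  zero_mem' := by
    refine ⟨ae_restrict_of_ae (Lp.coeFn_zero ℂ 2 (muW ω)), 0, differentiableOn_const 0,
      ae_restrict_of_ae (Lp.coeFn_zero ℂ 2 (muW ω))⟩
  add_mem' := by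
    rintro a b ⟨ha0, F, hF, ha⟩ ⟨hb0, G, hG, hb⟩
    refine ⟨?_, F + G, hF.add hG, ?_⟩
    · filter_upwards [ae_restrict_of_ae (Lp.coeFn_add a b), ha0, hb0] with w h1 h2 h3
      rw [h1]; simp only [Pi.add_apply, h2, h3, Pi.zero_apply, add_zero]
    · filter_upwards [ae_restrict_of_ae (Lp.coeFn_add a b), ha, hb] with w h1 h2 h3
      rw [h1]; simp only [Pi.add_apply, h2, h3]
  smul_mem' := by
    rintro c a ⟨ha0, F, hF, ha⟩
    refine ⟨?_, c • F, hF.const_smul c, ?_⟩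
    · filter_upwards [ae_restrict_of_ae (Lp.coeFn_smul c a), ha0] with w h1 h2
      rw [h1]; simp only [Pi.smul_apply, h2, Pi.zero_apply, smul_zero]
    · filter_upwards [ae_restrict_of_ae (Lp.coeFn_smul c a), ha] with w h1 h2
      rw [h1]; simp only [Pi.smul_apply, h2]

instance (ω : ℂ → ℝ) (D : Set ℂ) :
    CompleteSpace ((localBergmanSub ω D).topologicalClosure) :=
  IsClosed.completeSpace_coe (hs := Submodule.isClosed_topologicalClosure _)

/-- The local projection `P_{α,δ}` (for `D = D(δτ(α))`), extended by zero off `D`,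
viewed as an operator of `L²_ω`. -/
def localProj (ω : ℂ → ℝ) (D : Set ℂ) : Lp ℂ 2 (muW ω) →L[ℂ] Lp ℂ 2 (muW ω) :=
  ((localBergmanSub ω D).topologicalClosure).subtypeL.comp
    (Submodule.orthogonalProjectionOnto ((localBergmanSub ω D).topologicalClosure))

-- STATEMENT 1 condition (2)
def SchattenCondTwo (τC : ℂ → ℝ) (c₁ c₂ : ℝ) (g : ℂ → ℂ) (p : ℝ) : Prop :=
  ∃ δ ∈ Set.Ioo 0 (mTau c₁ c₂), ∀ z : ℕ → ℂ, IsLattice τC δ z →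
    ∑' j : ℕ, (FdeltaSqE τC δ g (z j)) ^ (p / 2) < ⊤

-- condition (3) of the main theorem
def SchattenCondThree (τC : ℂ → ℝ) (φ : ℂ → ℝ) (c₁ c₂ : ℝ) (g : ℂ → ℂ) (p : ℝ) : Prop :=
  ∃ δ ∈ Set.Ioo 0 (mTau c₁ c₂), ∃ g₁ g₂ : ℂ → ℂ,
    (∀ z ∈ unitDisc, g z = g₁ z + g₂ z) ∧ ContDiffOn ℝ 1 g₂ unitDisc ∧
    ∀ z : ℕ → ℂ, IsLattice τC δ z →
      (∑' j : ℕ, (localMeanE τC δ g₁ (z j)) ^ (p / 2) < ⊤) ∧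
      (∑' j : ℕ, (localMeanE τC δ
        (fun w => dbar g₂ w / (Real.sqrt (laplacian φ w) : ℂ)) (z j)) ^ (p / 2) < ⊤)

section Part1

section SingularNumbers
variable {E F : Type*} [NormedAddCommGroup E] [NormedSpace ℂ E]
    [NormedAddCommGroup F] [NormedSpace ℂ F]

lemma singularNumber_nonneg (T : E →L[ℂ] F) (ν : ℕ) : 0 ≤ singularNumber T ν := by
  apply Real.sInf_nonneg
  rintro c ⟨K, _, rfl⟩
  exact norm_nonneg _

lemma singularNumber_le_of (T K : E →L[ℂ] F) (ν : ℕ)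
    (hK : Module.rank ℂ (LinearMap.range (K : E →ₗ[ℂ] F)) ≤ (ν : Cardinal)) :
    singularNumber T ν ≤ ‖T - K‖ := by
  apply csInf_le
  · refine ⟨0, ?_⟩
    rintro c ⟨K, _, rfl⟩
    exact norm_nonneg _
  · exact ⟨K, hK, rfl⟩

lemma singularNumber_antitone (T : E →L[ℂ] F) : Antitone (singularNumber T) := by
  intro a b hab
  apply le_csInf
  · refine ⟨‖T - 0‖, 0, ?_, rfl⟩
    simp
  · rintro c ⟨K, hK, rfl⟩
    exact singularNumber_le_of T K b (hK.trans (by exact_mod_cast hab))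

end SingularNumbers

lemma exists_inj_of_card {ι : Type*} (A : ℕ → Set ι) 
    (h : ∀ ν, ∀ S : Finset ι, S.card ≤ ν → ∃ i ∈ A ν, i ∉ S) :
    ∃ f : ℕ → ι, Function.Injective f ∧ ∀ ν, f ν ∈ A ν := by
  classical
  have key : ∀ n : ℕ, ∀ g : (m : ℕ) → m < n → ι, ∃ i ∈ A n, ∀ m (hm : m < n), g m hm ≠ i := by
    intro n g
    obtain ⟨i, hi, hiS⟩ := h n (Finset.univ.image fun m : Fin n => g m.1 m.2)
      (Finset.card_image_le.trans (by simp))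
    refine ⟨i, hi, fun m hm he => hiS ?_⟩
    simp only [Finset.mem_image, Finset.mem_univ, true_and]
    exact ⟨⟨m, hm⟩, he⟩
  choose c hc hc' using key
  let f : ℕ → ι := fun n => Nat.strongRec (motive := fun _ => ι) (fun n g => c n g) n
  have hf : ∀ n, f n = c n (fun m _ => f m) := by
    intro n
    show Nat.strongRec (motive := fun _ => ι) (fun n g => c n g) n = _
    rw [Nat.strongRec]
  refine ⟨f, ?_, fun ν => by rw [hf]; exact hc _ _⟩
  have hne : ∀ m n, m < n → f m ≠ f n := by
    intro m n hmn
    rw [hf n]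
    exact hc' n (fun m _ => f m) m hmn
  intro m n hmn
  rcases lt_trichotomy m n with h1 | h1 | h1
  · exact absurd hmn (hne _ _ h1)
  · exact h1
  · exact absurd hmn.symm (hne _ _ h1)

lemma summable_rearrange {ι : Type*} [Infinite ι] (s : ℕ → ℝ) (hs0 : ∀ n, 0 ≤ s n)
    (hs : Antitone s) (b : ι → ℝ) (hb : ∀ i, 0 ≤ b i) (p : ℝ) (hp : 0 < p)
    (hsum : Summable fun i => b i ^ p)
    (h : ∀ t > 0, ∀ hf : {i | t < b i}.Finite, s hf.toFinset.card ≤ t) :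
    Summable fun ν => s ν ^ p := by
  classical
  have hfin : ∀ t > 0, {i | t < b i}.Finite := by
    intro t ht
    have h1 := hsum.tendsto_cofinite_zero
    have h2 := h1.eventually (gt_mem_nhds (Real.rpow_pos_of_pos ht p))
    rw [Filter.eventually_cofinite] at h2
    refine h2.subset ?_
    intro i hi
    simp only [mem_setOf_eq, not_lt] at hi ⊢
    exact Real.rpow_le_rpow ht.le hi.le hp.le
  obtain ⟨f, hf, hfA⟩ := exists_inj_of_card (fun ν => {i | s ν ≤ b i}) (by
    intro ν S hS
    by_contra! hcon
    simp only [mem_setOf_eq] at hcon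
    rcases (hs0 ν).eq_or_lt with h0 | h0
    · obtain ⟨i, hi⟩ := Infinite.exists_notMem_finset S
      exact hi (hcon i (by rw [← h0]; exact hb i))
    · -- choose t < s ν such that {b > t} ⊆ S
      have : ∃ t, 0 < t ∧ t < s ν ∧ {i | t < b i} ⊆ S := by
        have hF := hfin (s ν / 2) (by linarith)
        let V := hF.toFinset.filter (fun i => b i < s ν)
        obtain ⟨t, ht⟩ : ∃ t, s ν / 2 ≤ t ∧ t < s ν ∧ ∀ i ∈ V, b i ≤ t := by
          have : ∀ W : Finset ι, (∀ i ∈ W, b i < s ν) → ∃ t, s ν / 2 ≤ t ∧ t < s ν ∧ ∀ i ∈ W, b i ≤ t := by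
            intro W
            induction W using Finset.induction_on with
            | empty => intro _; exact ⟨s ν / 2, le_rfl, by linarith, by simp⟩
            | insert a W _ ih =>
              intro hW
              obtain ⟨t, h1, h2, h3⟩ := ih (fun i hi => hW i (Finset.mem_insert_of_mem hi))
              refine ⟨max t (b a), h1.trans (le_max_left _ _), max_lt h2 (hW a (Finset.mem_insert_self _ _)), ?_⟩
              intro i hi
              rcases Finset.mem_insert.1 hi with rfl | hi
              · exact le_max_right _ _
              · exact (h3 i hi).trans (le_max_left _ _)
          exact this V (fun i hi => (Finset.mem_filter.1 hi).2)
        refine ⟨t, by linarith, ht.2.1, ?_⟩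
        intro i hi
        simp only [mem_setOf_eq] at hi
        by_cases hib : b i < s ν
        · have : i ∈ V := by
            simp only [V, Finset.mem_filter, Set.Finite.mem_toFinset, mem_setOf_eq]
            exact ⟨by linarith, hib⟩
          exact absurd (ht.2.2 i this) (by linarith)
        · exact hcon i (not_lt.1 hib)
      obtain ⟨t, ht0, ht, hsub⟩ := this
      have h1 := h t ht0 (hfin t ht0)
      have h2 : (hfin t ht0).toFinset.card ≤ ν := by
        refine (Finset.card_le_card ?_).trans hS
        intro i hi
        exact hsub ((Set.Finite.mem_toFinset _).1 hi)
      have := hs h2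
      linarith)
  refine Summable.of_nonneg_of_le (fun ν => Real.rpow_nonneg (hs0 ν) p)
    (fun ν => Real.rpow_le_rpow (hs0 ν) (hfA ν) hp.le) (hsum.comp_injective hf)

open Polynomial in
lemma singularNumber_le_of_polynomial {E F : Type*} [NormedAddCommGroup E] [InnerProductSpace ℂ E]
    [CompleteSpace E] [NormedAddCommGroup F] [NormedSpace ℂ F] (T : E →L[ℂ] F)
    (L : ℂ[X] →ₗ[ℂ] E) (hL : DenseRange L) (q : ℂ[X]) (hq : q.Monic) (c : ℝ) (hc : 0 ≤ c)
    (h : ∀ a : ℂ[X], ‖T (L (q * a))‖ ≤ c * ‖L (q * a)‖) :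
    singularNumber T q.natDegree ≤ c := by
  let M0 : Submodule ℂ E := LinearMap.range (L ∘ₗ LinearMap.mulLeft ℂ q)
  let M := M0.topologicalClosure
  haveI : CompleteSpace M :=
    IsClosed.completeSpace_coe (hs := Submodule.isClosed_topologicalClosure _)
  have hM : ∀ x ∈ M, ‖T x‖ ≤ c * ‖x‖ := by
    intro x hx
    have hcl : IsClosed {x : E | ‖T x‖ ≤ c * ‖x‖} := isClosed_le (by fun_prop) (by fun_prop)
    have : (M : Set E) ⊆ {x : E | ‖T x‖ ≤ c * ‖x‖} := by
      rw [Submodule.topologicalClosure_coe]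
      refine closure_minimal ?_ hcl
      rintro _ ⟨a, rfl⟩
      exact h a
    exact this hx
  let Q : E →L[ℂ] E := M.starProjection
  let K : E →L[ℂ] F := T.comp (ContinuousLinearMap.id ℂ E - Q)
  have hQM : ∀ x ∈ M, Q x = x := fun x hx => Submodule.starProjection_eq_self_iff.2 hx
  have hTK : ‖T - K‖ ≤ c := by
    refine ContinuousLinearMap.opNorm_le_bound _ hc (fun x => ?_)
    have : (T - K) x = T (Q x) := by simp [K]
    rw [this]
    refine (hM _ (Submodule.starProjection_apply_mem _ _)).trans ?_
    gcongr
    exact Submodule.norm_starProjection_apply_le _ _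
  refine (singularNumber_le_of T K _ ?_).trans hTK
  -- rank
  let W : Submodule ℂ F := Submodule.map (K : E →ₗ[ℂ] F) (Submodule.map L (degreeLT ℂ q.natDegree))
  have hfd : Module.Finite ℂ (degreeLT ℂ q.natDegree) :=
    Module.Finite.equiv (degreeLTEquiv ℂ q.natDegree).symm
  have hrk : Module.finrank ℂ (degreeLT ℂ q.natDegree) = q.natDegree := by
    rw [(degreeLTEquiv ℂ q.natDegree).finrank_eq]; simp
  haveI : FiniteDimensional ℂ W := by
    show Module.Finite ℂ W
    infer_instance
  have hW : Module.rank ℂ W ≤ (q.natDegree : Cardinal) := by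
    rw [← Module.finrank_eq_rank]
    have h1 := Submodule.finrank_map_le (K : E →ₗ[ℂ] F) (Submodule.map L (degreeLT ℂ q.natDegree))
    have h2 := Submodule.finrank_map_le L (degreeLT ℂ q.natDegree)
    exact_mod_cast h1.trans (h2.trans hrk.le)
  refine (Submodule.rank_mono ?_).trans hW
  rintro _ ⟨x, rfl⟩
  have hWc : IsClosed (W : Set F) := Submodule.closed_of_finiteDimensional W
  have hcl : IsClosed {x : E | K x ∈ W} := hWc.preimage K.continuous
  have : (Set.univ : Set E) ⊆ {x : E | K x ∈ W} := by
    rw [← hL.closure_range]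
    refine closure_minimal ?_ hcl
    rintro _ ⟨a, rfl⟩
    have hdiv : a %ₘ q + q * (a /ₘ q) = a := Polynomial.modByMonic_add_div a q
    have h1 : K (L (q * (a /ₘ q))) = 0 := by
      have : L (q * (a /ₘ q)) ∈ M := Submodule.le_topologicalClosure _ ⟨a /ₘ q, rfl⟩
      simp [K, hQM _ this]
    have h2 : K (L a) = K (L (a %ₘ q)) := by
      conv_lhs => rw [← hdiv]
      rw [map_add, map_add, h1, add_zero]
    simp only [mem_setOf_eq]
    rw [h2]
    refine ⟨_, ⟨a %ₘ q, ?_, rfl⟩, rfl⟩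
    rw [SetLike.mem_coe, mem_degreeLT]
    by_cases hq1 : q = 1
    · subst hq1; simp
    rw [← degree_eq_natDegree hq.ne_zero]
    exact degree_modByMonic_lt a hq
  exact this (mem_univ x)
end Part1

lemma exists_seq_strong {α : Type*} [DecidableEq α] (P : Finset α → α → Prop)
    (h : ∀ S, ∃ a, P S a) :
    ∃ f : ℕ → α, ∀ n, P ((Finset.range n).image f) (f n) := by
  choose c hc using h
  let f : ℕ → α := fun n => Nat.strongRec (motive := fun _ => α)
    (fun n g => c (Finset.univ.image fun m : Fin n => g m.1 m.2)) n
  have hf : ∀ n, f n = c ((Finset.range n).image f) := by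
    intro n
    have h1 : f n = c (Finset.univ.image fun m : Fin n => f m.1) := by
      show Nat.strongRec (motive := fun _ => α)
        (fun n g => c (Finset.univ.image fun m : Fin n => g m.1 m.2)) n = _
      rw [Nat.strongRec]
    rw [h1]
    congr 1
    ext a
    simp only [Finset.mem_image, Finset.mem_univ, true_and, Finset.mem_range]
    constructor
    · rintro ⟨m, rfl⟩; exact ⟨m.1, m.2, rfl⟩
    · rintro ⟨m, hm, rfl⟩; exact ⟨⟨m, hm⟩, rfl⟩
  refine ⟨f, fun n => ?_⟩
  have := hc ((Finset.range n).image f)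
  rwa [← hf n] at this

lemma mTau_facts {c₁ c₂ δ : ℝ} (h1 : 0 < c₁) (h2 : 0 < c₂) (hδ : δ ∈ Set.Ioo 0 (mTau c₁ c₂)) :
    0 < δ ∧ δ < 1 / 4 ∧ δ * c₁ < 1 / 4 ∧ δ * c₂ < 1 / 4 := by
  obtain ⟨h0, hδ⟩ := hδ
  unfold mTau at hδ
  have ha : δ < 1 / 4 := by
    have : min 1 (min c₁⁻¹ c₂⁻¹) ≤ 1 := min_le_left _ _
    linarith
  have hb : 4 * δ < c₁⁻¹ := by
    have : min 1 (min c₁⁻¹ c₂⁻¹) ≤ c₁⁻¹ := (min_le_right _ _).trans (min_le_left _ _)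
    linarith
  have hc : 4 * δ < c₂⁻¹ := by
    have : min 1 (min c₁⁻¹ c₂⁻¹) ≤ c₂⁻¹ := (min_le_right _ _).trans (min_le_right _ _)
    linarith
  refine ⟨h0, ha, ?_, ?_⟩
  · have := mul_lt_mul_of_pos_right hb h1
    rw [inv_mul_cancel₀ h1.ne'] at this
    linarith
  · have := mul_lt_mul_of_pos_right hc h2
    rw [inv_mul_cancel₀ h2.ne'] at this
    linarith

lemma mem_unitDisc {z : ℂ} : z ∈ unitDisc ↔ ‖z‖ < 1 := by
  simp [unitDisc]

lemma packing (w : ℂ) (ρ A B : ℝ) (hρ : 0 < ρ) (hA : 0 < A) (hB : 0 < B) (t : Finset ℂ)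
    (h1 : ∀ z ∈ t, ‖z - w‖ < A * ρ)
    (h2 : ∀ z ∈ t, ∀ z' ∈ t, z ≠ z' → 2 * B * ρ ≤ ‖z - z'‖) :
    (t.card : ℝ) * B ^ 2 ≤ (A + B) ^ 2 := by
  have hdisj : (t : Set ℂ).PairwiseDisjoint (fun z => Metric.ball z (B * ρ)) := by
    intro z hz z' hz' hne
    apply Metric.ball_disjoint_ball
    rw [dist_eq_norm]
    linarith [h2 z hz z' hz' hne]
  have hvol : volume (⋃ z ∈ t, Metric.ball z (B * ρ)) = ∑ z ∈ t, volume (Metric.ball z (B * ρ)) :=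
    measure_biUnion_finset hdisj (fun _ _ => measurableSet_ball)
  have hsub : (⋃ z ∈ t, Metric.ball z (B * ρ)) ⊆ Metric.ball w ((A + B) * ρ) := by
    intro x hx
    simp only [mem_iUnion, Metric.mem_ball, dist_eq_norm] at hx ⊢
    obtain ⟨z, hz, hx⟩ := hx
    have := norm_sub_le_norm_sub_add_norm_sub x z w
    have := h1 z hz
    nlinarith
  have hle := measure_mono (μ := volume) hsub
  rw [hvol] at hle
  simp only [Complex.volume_ball, Finset.sum_const, nsmul_eq_mul] at hle
  rw [← mul_assoc] at hle
  have hpi : (NNReal.pi : ℝ≥0∞) ≠ 0 := by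
    simp [NNReal.pi_ne_zero]
  have hle2 := (ENNReal.mul_le_mul_iff_left hpi ENNReal.coe_ne_top).1 hle
  rw [← ENNReal.ofReal_pow (by positivity), ← ENNReal.ofReal_pow (by positivity),
    ← ENNReal.ofReal_natCast, ← ENNReal.ofReal_mul (by positivity),
    ENNReal.ofReal_le_ofReal_iff (by positivity)] at hle2
  have : 0 < ρ ^ 2 := by positivity
  nlinarith

lemma lattice_mult {τC : ℂ → ℝ} {c₁ c₂ δ : ℝ} (hL : IsClassL τC c₁ c₂)
    (hδ : δ ∈ Set.Ioo 0 (mTau c₁ c₂)) (z : ℕ → ℂ) (hz : ∀ j, z j ∈ unitDisc)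
    (hsep : ∀ j k, j ≠ k → z j ∉ Metric.ball (z k) (δ * τC (z k)))
    (w : ℂ) (hw : w ∈ unitDisc) (t : Finset ℕ)
    (ht : ∀ j ∈ t, w ∈ Metric.ball (z j) (3 * (δ * τC (z j)))) : t.card ≤ 1849 := by
  obtain ⟨hδ0, hδ1, hδc₁, hδc₂⟩ := mTau_facts hL.c₁_pos hL.c₂_pos hδ
  have hinj : Set.InjOn z t := by
    intro i hi j hj hij
    by_contra hne
    apply hsep i j hne
    rw [hij]
    exact Metric.mem_ball_self (mul_pos hδ0 (hL.pos _ (hz j)))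
  have hcomp : ∀ j ∈ t, ‖z j - w‖ < 12 * (δ * τC w) ∧ 4 / 7 * (δ * τC w) ≤ δ * τC (z j) := by
    intro j hj
    have h1 := ht j hj
    rw [Metric.mem_ball, dist_comm, dist_eq_norm] at h1
    have h2 := abs_le.1 (hL.lip _ (hz j) _ hw)
    have h3 : c₂ * ‖z j - w‖ ≤ 3 / 4 * τC (z j) := by
      have h4 := hL.pos _ (hz j)
      have : c₂ * ‖z j - w‖ ≤ c₂ * (3 * (δ * τC (z j))) := by
        have := hL.c₂_pos
        gcongr
      nlinarith
    constructor
    · have : τC (z j) ≤ 4 * τC w := by linarith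
      nlinarith
    · have : 4 / 7 * τC w ≤ τC (z j) := by linarith
      nlinarith
  have h := packing w (δ * τC w) 12 (2/7) (mul_pos hδ0 (hL.pos _ hw)) (by norm_num) (by norm_num)
    (t.image z) (by
      intro x hx
      obtain ⟨j, hj, rfl⟩ := Finset.mem_image.1 hx
      exact (hcomp j hj).1) (by
      intro x hx y hy hxy
      obtain ⟨j, hj, rfl⟩ := Finset.mem_image.1 hx
      obtain ⟨k, hk, rfl⟩ := Finset.mem_image.1 hy
      have hjk : j ≠ k := fun h => hxy (by rw [h])
      have := hsep j k hjk
      rw [Metric.mem_ball, dist_eq_norm, not_lt] at this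
      linarith [(hcomp k hk).2])
  rw [Finset.card_image_of_injOn hinj] at h
  have : (t.card : ℝ) ≤ 1849 := by nlinarith
  exact_mod_cast this

lemma exists_lattice {τ : ℝ → ℝ} {c₁ c₂ δ : ℝ} (hL : IsClassL (radialize τ) c₁ c₂)
    (hanti : AntitoneOn τ (Set.Ico 0 1))
    (hδ : δ ∈ Set.Ioo 0 (mTau c₁ c₂)) : ∃ z, IsLattice (radialize τ) δ z := by
  classical
  obtain ⟨hδ0, hδ1, hδc₁, hδc₂⟩ := mTau_facts hL.c₁_pos hL.c₂_pos hδ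
  have hR : ∀ w ∈ unitDisc, δ * radialize τ w ≤ (1 - ‖w‖) / 4 := by
    intro w hw
    have := hL.upper w hw
    have h2 := mem_unitDisc.1 hw
    nlinarith
  obtain ⟨z, hz⟩ := exists_seq_strong (α := ℂ) (fun S a => (∀ x ∈ S, x ∈ unitDisc) →
    a ∈ unitDisc ∧ (∀ x ∈ S, a ∉ Metric.ball x (δ * radialize τ x)) ∧
    ∀ w ∈ unitDisc, (∀ x ∈ S, w ∉ Metric.ball x (δ * radialize τ x)) → ‖a‖ ≤ ‖w‖) (by
    intro S
    by_cases hS : ∀ x ∈ S, x ∈ unitDisc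
    swap
    · exact ⟨0, fun h => absurd h hS⟩
    -- nonempty
    obtain ⟨ρ, hρ0, hρ1, hρ⟩ : ∃ ρ : ℝ, 0 ≤ ρ ∧ ρ < 1 ∧ ∀ x ∈ S, ‖x‖ + (1 - ‖x‖) / 4 ≤ ρ := by
      have : ∀ S : Finset ℂ, (∀ x ∈ S, x ∈ unitDisc) →
          ∃ ρ : ℝ, 0 ≤ ρ ∧ ρ < 1 ∧ ∀ x ∈ S, ‖x‖ + (1 - ‖x‖) / 4 ≤ ρ := by
        intro S
        induction S using Finset.induction_on with
        | empty => intro _; exact ⟨0, le_rfl, by norm_num, by simp⟩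
        | insert a S _ ih =>
          intro hS
          obtain ⟨t, h1, h2, h3⟩ := ih (fun i hi => hS i (Finset.mem_insert_of_mem hi))
          refine ⟨max t (‖a‖ + (1 - ‖a‖) / 4), h1.trans (le_max_left _ _), max_lt h2 ?_, ?_⟩
          · have := mem_unitDisc.1 (hS a (Finset.mem_insert_self _ _))
            linarith
          · intro i hi
            rcases Finset.mem_insert.1 hi with rfl | hi
            · exact le_max_right _ _
            · exact (h3 i hi).trans (le_max_left _ _)
      exact this S hS
    let U : Set ℂ := {w | w ∈ Metric.closedBall (0 : ℂ) ρ ∧ ∀ x ∈ S, w ∉ Metric.ball x (δ * radialize τ x)}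
    have hU : IsCompact U := by
      have : U = Metric.closedBall (0 : ℂ) ρ ∩ ⋂ x ∈ S, (Metric.ball x (δ * radialize τ x))ᶜ := by
        ext w; simp [U]
      rw [this]
      refine (isCompact_closedBall _ _).inter_right ?_
      exact isClosed_biInter fun x _ => Metric.isOpen_ball.isClosed_compl
    have hUne : U.Nonempty := by
      refine ⟨(ρ : ℂ), ?_, ?_⟩
      · simp [abs_of_nonneg hρ0]
      · intro x hx hmem
        rw [Metric.mem_ball, dist_eq_norm] at hmem
        have h1 := hR x (hS x hx)
        have h2 := hρ x hx
        have h3 := norm_sub_norm_le (ρ : ℂ) x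
        rw [Complex.norm_real, Real.norm_of_nonneg hρ0] at h3
        linarith
    obtain ⟨a, haU, ha⟩ := hU.exists_isMinOn hUne continuous_norm.continuousOn
    refine ⟨a, fun _ => ⟨?_, haU.2, ?_⟩⟩
    · have := haU.1
      rw [mem_closedBall_zero_iff] at this
      exact mem_unitDisc.2 (by linarith)
    · intro w hw hwS
      by_cases hwρ : ‖w‖ ≤ ρ
      · exact ha (show w ∈ U from ⟨by simpa using hwρ, hwS⟩)
      · have := haU.1
        rw [mem_closedBall_zero_iff] at this
        linarith)
  have hmem : ∀ n, z n ∈ unitDisc := by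
    intro n
    induction n using Nat.strong_induction_on with
    | _ n ih =>
      refine (hz n ?_).1
      intro x hx
      obtain ⟨m, hm, rfl⟩ := Finset.mem_image.1 hx
      exact ih m (Finset.mem_range.1 hm)
  have hz' : ∀ n, (∀ m < n, z n ∉ Metric.ball (z m) (δ * radialize τ (z m))) ∧
      ∀ w ∈ unitDisc, (∀ m < n, w ∉ Metric.ball (z m) (δ * radialize τ (z m))) → ‖z n‖ ≤ ‖w‖ := by
    intro n
    have := hz n (by
      intro x hx
      obtain ⟨m, hm, rfl⟩ := Finset.mem_image.1 hx
      exact hmem m)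
    refine ⟨fun m hm => this.2.1 _ (Finset.mem_image_of_mem _ (Finset.mem_range.2 hm)), ?_⟩
    intro w hw h
    refine this.2.2 w hw ?_
    intro x hx
    obtain ⟨m, hm, rfl⟩ := Finset.mem_image.1 hx
    exact h m (Finset.mem_range.1 hm)
  have hIco : ∀ w ∈ unitDisc, ‖w‖ ∈ Set.Ico (0 : ℝ) 1 := fun w hw =>
    ⟨norm_nonneg _, mem_unitDisc.1 hw⟩
  have hmono : ∀ m n, m ≤ n → ‖z m‖ ≤ ‖z n‖ := by
    intro m n hmn
    refine (hz' m).2 _ (hmem n) ?_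
    intro k hk
    exact (hz' n).1 k (lt_of_lt_of_le hk hmn)
  have hsep : ∀ j k, j ≠ k → z j ∉ Metric.ball (z k) (δ * radialize τ (z k)) := by
    intro j k hjk
    rcases lt_or_gt_of_ne hjk with h | h
    · have h1 := (hz' k).1 j h
      rw [Metric.mem_ball, dist_comm, not_lt] at h1
      rw [Metric.mem_ball, not_lt]
      refine le_trans ?_ h1
      have : radialize τ (z k) ≤ radialize τ (z j) :=
        hanti (hIco _ (hmem j)) (hIco _ (hmem k)) (hmono j k h.le)
      gcongr
    · exact (hz' j).1 k h
  refine ⟨z, hmem, hsep, ?_, 1849, ?_⟩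
  · intro w hw
    by_contra! hcon
    have hle : ∀ n, ‖z n‖ ≤ ‖w‖ := fun n => (hz' n).2 w hw (fun m _ => hcon m)
    obtain ⟨x, -, ψ, hψ, hlim⟩ := (isCompact_closedBall (0 : ℂ) ‖w‖).tendsto_subseq
      (fun n => mem_closedBall_zero_iff.2 (hle n))
    have hpos : 0 < δ * radialize τ w := mul_pos hδ0 (hL.pos _ hw)
    obtain ⟨N, hN⟩ := Metric.cauchySeq_iff.1 hlim.cauchySeq _ hpos
    have h1 := hN (N+1) (by omega) N le_rfl
    have h2 := hsep (ψ (N+1)) (ψ N) (hψ.injective.ne (by omega))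
    rw [Metric.mem_ball, not_lt] at h2
    have : radialize τ w ≤ radialize τ (z (ψ N)) :=
        hanti (hIco _ (hmem _)) (hIco _ hw) (hle _)
    simp only [Function.comp_apply] at h1
    nlinarith
  · intro w hw
    by_cases hfin : {j : ℕ | w ∈ Metric.ball (z j) (3 * (δ * radialize τ (z j)))}.Finite
    · rw [Set.ncard_eq_toFinset_card _ hfin]
      exact lattice_mult hL hδ z hmem hsep w hw _ (fun j hj => by have := (Set.Finite.mem_toFinset hfin).1 hj; exact this)
    · rw [Set.Infinite.ncard hfin]; norm_num

lemma isOpen_unitDisc : IsOpen unitDisc := Metric.isOpen_ball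

section supp
variable {V : Type*} [NormedAddCommGroup V]

/-- a function vanishing off a compact subset of the disc and continuous on the disc. -/
structure CSupp (f : ℂ → V) (K : Set ℂ) : Prop where
  cont : ContinuousOn f unitDisc
  zero : ∀ z, z ∉ K → f z = 0

lemma CSupp.continuous {f : ℂ → V} {K : Set ℂ} (h : CSupp f K) (hK : IsCompact K)
    (hKD : K ⊆ unitDisc) : Continuous f := by
  apply continuous_of_tsupport
  intro x hx
  have : tsupport f ⊆ K := closure_minimal (fun z hz => by
    by_contra hzK; exact hz (h.zero z hzK)) hK.isClosed
  exact h.cont.continuousAt (isOpen_unitDisc.mem_nhds (hKD (this hx)))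

lemma CSupp.hasCompactSupport {f : ℂ → V} {K : Set ℂ} (h : CSupp f K) (hK : IsCompact K) :
    HasCompactSupport f := HasCompactSupport.intro hK h.zero

lemma CSupp.integrable {f : ℂ → V} {K : Set ℂ} (h : CSupp f K) (hK : IsCompact K)
    (hKD : K ⊆ unitDisc) : Integrable f volume :=
  (h.continuous hK hKD).integrable_of_hasCompactSupport (h.hasCompactSupport hK)

end supp

lemma integral_fderiv_zero {F : ℂ → ℝ} {K : Set ℂ} (hK : IsCompact K) (hKD : K ⊆ unitDisc)
    (hF : ContDiffOn ℝ 1 F unitDisc) (h0 : ∀ z, z ∉ K → F z = 0) (v : ℂ) :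
    CSupp (fun z => fderiv ℝ F z v) K ∧ ∫ z, fderiv ℝ F z v = 0 := by
  have hts : tsupport F ⊆ K := closure_minimal (fun z hz => by
    by_contra hzK; exact hz (h0 z hzK)) hK.isClosed
  have h1 : CSupp (fun z => fderiv ℝ F z v) K := by
    constructor
    · exact (hF.continuousOn_fderiv_of_isOpen isOpen_unitDisc le_rfl).clm_apply continuousOn_const
    · intro z hz
      have : fderiv ℝ F z = 0 := by
        have h2 : z ∉ tsupport F := fun h => hz (hts h)
        exact Function.notMem_support.1 (fun h => h2 (support_fderiv_subset ℝ h))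
      rw [this]; rfl
  have h2 : CSupp F K := ⟨hF.continuousOn, h0⟩
  refine ⟨h1, ?_⟩
  have := integral_mul_fderiv_eq_neg_fderiv_mul_of_integrable (μ := (volume : Measure ℂ))
    (f := fun _ : ℂ => (1 : ℝ)) (g := F) (v := v) (by simp) (by simpa using h1.integrable hK hKD)
    (by simpa using h2.integrable hK hKD) (fun x _ => by fun_prop) (by
      intro x _
      by_cases hx : x ∈ unitDisc
      · exact (hF.contDiffAt (isOpen_unitDisc.mem_nhds hx)).differentiableAt (by norm_num)
      · have hxK : x ∉ tsupport F := fun h => hx (hKD (hts h))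
        have : F =ᶠ[nhds x] fun _ => 0 := by
          filter_upwards [(isClosed_tsupport F).isOpen_compl.mem_nhds hxK] with y hy
          exact image_eq_zero_of_notMem_tsupport hy
        exact (differentiableAt_const _).congr_of_eventuallyEq this)
  simpa using this

lemma ibp_fderiv {F b : ℂ → ℂ} (hF : ContDiffOn ℝ 1 F unitDisc) (hb : ContDiff ℝ 1 b)
    (hc : HasCompactSupport b) (hs : tsupport b ⊆ unitDisc) (v : ℂ) :
    Integrable (fun z => F z * fderiv ℝ b z v) ∧ Integrable (fun z => fderiv ℝ F z v * b z) ∧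
    ∫ z, F z * fderiv ℝ b z v = - ∫ z, fderiv ℝ F z v * b z := by
  have e1 : CSupp (fun z => fderiv ℝ F z v * b z) (tsupport b) := by
    constructor
    · exact ((hF.continuousOn_fderiv_of_isOpen isOpen_unitDisc le_rfl).clm_apply
        continuousOn_const).mul hb.continuous.continuousOn
    · intro z hz
      simp [image_eq_zero_of_notMem_tsupport hz]
  have e2 : CSupp (fun z => F z * fderiv ℝ b z v) (tsupport b) := by
    constructor
    · exact hF.continuousOn.mul ((hb.continuous_fderiv (by norm_num)).clm_apply
        continuous_const).continuousOn
    · intro z hz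
      have : fderiv ℝ b z = 0 := Function.notMem_support.1 (fun h => hz (support_fderiv_subset ℝ h))
      simp [this]
  have e3 : CSupp (fun z => F z * b z) (tsupport b) := by
    constructor
    · exact hF.continuousOn.mul hb.continuous.continuousOn
    · intro z hz
      simp [image_eq_zero_of_notMem_tsupport hz]
  refine ⟨e2.integrable hc hs, e1.integrable hc hs, ?_⟩
  apply integral_mul_fderiv_eq_neg_fderiv_mul_of_integrable (e1.integrable hc hs)
    (e2.integrable hc hs) (e3.integrable hc hs)
  · intro x hx
    exact (hF.contDiffAt (isOpen_unitDisc.mem_nhds (hs hx))).differentiableAt (by norm_num)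
  · intro x _
    exact hb.differentiable (by norm_num) x

lemma ibp_dbar {F b : ℂ → ℂ} (hF : ContDiffOn ℝ 1 F unitDisc) (hb : ContDiff ℝ 1 b)
    (hc : HasCompactSupport b) (hs : tsupport b ⊆ unitDisc) :
    ∫ z, F z * dbar b z = - ∫ z, dbar F z * b z := by
  obtain ⟨i1, j1, h1⟩ := ibp_fderiv hF hb hc hs 1
  obtain ⟨i2, j2, h2⟩ := ibp_fderiv hF hb hc hs Complex.I
  have e1 : (fun z => F z * dbar b z) = fun z => (1 / 2 : ℂ) * (F z * fderiv ℝ b z 1) +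
      (Complex.I / 2) * (F z * fderiv ℝ b z Complex.I) := by
    funext z; simp only [dbar]; ring
  have e2 : (fun z => dbar F z * b z) = fun z => (1 / 2 : ℂ) * (fderiv ℝ F z 1 * b z) +
      (Complex.I / 2) * (fderiv ℝ F z Complex.I * b z) := by
    funext z; simp only [dbar]; ring
  rw [e1, e2, integral_add (i1.const_mul _) (i2.const_mul _),
    integral_add (j1.const_mul _) (j2.const_mul _), integral_const_mul, integral_const_mul,
    integral_const_mul, integral_const_mul, h1, h2]
  ring

lemma hasDerivAt_line {F : ℂ → ℝ} {z : ℂ} (h : DifferentiableAt ℝ F z) (v : ℂ) :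
    HasDerivAt (fun t : ℝ => F (z + t • v)) (fderiv ℝ F z v) 0 :=
  h.hasFDerivAt.hasLineDerivAt v

lemma fderiv_eq_of_line {F : ℂ → ℝ} {z v : ℂ} {d : ℝ} (h : DifferentiableAt ℝ F z)
    (hd : HasDerivAt (fun t : ℝ => F (z + t • v)) d 0) : fderiv ℝ F z v = d :=
  (hasDerivAt_line h v).unique hd

lemma fderiv_symm {u : ℂ → ℝ} {z : ℂ} (hu : ContDiffAt ℝ 2 u z) (a c : ℂ) :
    fderiv ℝ (fun w => fderiv ℝ u w a) z c = fderiv ℝ (fun w => fderiv ℝ u w c) z a := by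
  have hd : DifferentiableAt ℝ (fderiv ℝ u) z :=
    (hu.fderiv_right (m := 1) (by norm_num)).differentiableAt (by norm_num)
  have h1 : ∀ a c : ℂ, fderiv ℝ (fun w => fderiv ℝ u w a) z c = fderiv ℝ (fderiv ℝ u) z c a := by
    intro a c
    rw [fderiv_clm_apply hd (differentiableAt_const _)]
    simp
  rw [h1, h1]
  exact (hu.isSymmSndFDerivAt (by simp)) c a

section horm
variable (φ u v : ℂ → ℝ)

/-- first component of the divergence term -/
def X1 (z : ℂ) : ℝ := Real.exp (2 * φ z) * (-2 * (u z * u z + v z * v z) * fderiv ℝ φ z 1 +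
  2 * (v z * fderiv ℝ u z Complex.I - u z * fderiv ℝ v z Complex.I))
/-- second component of the divergence term -/
def X2 (z : ℂ) : ℝ := Real.exp (2 * φ z) * (-2 * (u z * u z + v z * v z) * fderiv ℝ φ z Complex.I -
  2 * (v z * fderiv ℝ u z 1 - u z * fderiv ℝ v z 1))
/-- the positive remainder -/
def Rem (z : ℂ) : ℝ := Real.exp (2 * φ z) *
  ((fderiv ℝ u z 1 + fderiv ℝ v z Complex.I + 2 * (fderiv ℝ φ z 1 * u z + fderiv ℝ φ z Complex.I * v z)) ^ 2
  + (fderiv ℝ v z 1 - fderiv ℝ u z Complex.I + 2 * (fderiv ℝ φ z 1 * v z - fderiv ℝ φ z Complex.I * u z)) ^ 2)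

variable {φ u v}

lemma contDiffAt_fderiv_apply {f : ℂ → ℝ} {z : ℂ} (h : ContDiffAt ℝ 2 f z) (a : ℂ) :
    ContDiffAt ℝ 1 (fun w => fderiv ℝ f w a) z :=
  (h.fderiv_right (m := 1) (by norm_num)).clm_apply contDiffAt_const

lemma contDiffAt_X1 {z : ℂ} (hφ : ContDiffAt ℝ 2 φ z) (hu : ContDiffAt ℝ 2 u z)
    (hv : ContDiffAt ℝ 2 v z) : ContDiffAt ℝ 1 (X1 φ u v) z := by
  have := contDiffAt_fderiv_apply hφ 1
  have := contDiffAt_fderiv_apply hu Complex.I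
  have := contDiffAt_fderiv_apply hv Complex.I
  have := hφ.of_le (m := 1) (by norm_num)
  have := hu.of_le (m := 1) (by norm_num)
  have := hv.of_le (m := 1) (by norm_num)
  unfold X1
  fun_prop

lemma contDiffAt_X2 {z : ℂ} (hφ : ContDiffAt ℝ 2 φ z) (hu : ContDiffAt ℝ 2 u z)
    (hv : ContDiffAt ℝ 2 v z) : ContDiffAt ℝ 1 (X2 φ u v) z := by
  have := contDiffAt_fderiv_apply hφ Complex.I
  have := contDiffAt_fderiv_apply hu 1
  have := contDiffAt_fderiv_apply hv 1
  have := hφ.of_le (m := 1) (by norm_num)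
  have := hu.of_le (m := 1) (by norm_num)
  have := hv.of_le (m := 1) (by norm_num)
  unfold X2
  fun_prop

lemma horm_identity {z : ℂ} (hφ : ContDiffAt ℝ 2 φ z) (hu : ContDiffAt ℝ 2 u z)
    (hv : ContDiffAt ℝ 2 v z) :
    Real.exp (2 * φ z) * ((fderiv ℝ u z 1 - fderiv ℝ v z Complex.I) ^ 2 +
      (fderiv ℝ u z Complex.I + fderiv ℝ v z 1) ^ 2) =
    Rem φ u v z + 2 * (Real.exp (2 * φ z) * (u z * u z + v z * v z) * laplacian φ z) +
      (fderiv ℝ (X1 φ u v) z 1 + fderiv ℝ (X2 φ u v) z Complex.I) := by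
  have dφ := hφ.differentiableAt (by norm_num)
  have du := hu.differentiableAt (by norm_num)
  have dv := hv.differentiableAt (by norm_num)
  have dd : ∀ {f : ℂ → ℝ}, ContDiffAt ℝ 2 f z → ∀ a, DifferentiableAt ℝ (fun w => fderiv ℝ f w a) z :=
    fun h a => (contDiffAt_fderiv_apply h a).differentiableAt (by norm_num)
  have e1 := fderiv_eq_of_line (v := 1) ((contDiffAt_X1 hφ hu hv).differentiableAt (by norm_num))
    (((hasDerivAt_line dφ 1).const_mul 2).exp.mul
     ((((((hasDerivAt_line du 1).mul (hasDerivAt_line du 1)).add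
        ((hasDerivAt_line dv 1).mul (hasDerivAt_line dv 1))).const_mul (-2)).mul
        (hasDerivAt_line (dd hφ 1) 1)).add
      ((((hasDerivAt_line dv 1).mul (hasDerivAt_line (dd hu Complex.I) 1)).sub
       ((hasDerivAt_line du 1).mul (hasDerivAt_line (dd hv Complex.I) 1))).const_mul 2)))
  have e2 := fderiv_eq_of_line (v := Complex.I) ((contDiffAt_X2 hφ hu hv).differentiableAt (by norm_num))
    (((hasDerivAt_line dφ Complex.I).const_mul 2).exp.mul
     ((((((hasDerivAt_line du Complex.I).mul (hasDerivAt_line du Complex.I)).add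
        ((hasDerivAt_line dv Complex.I).mul (hasDerivAt_line dv Complex.I))).const_mul (-2)).mul
        (hasDerivAt_line (dd hφ Complex.I) Complex.I)).sub
      ((((hasDerivAt_line dv Complex.I).mul (hasDerivAt_line (dd hu 1) Complex.I)).sub
       ((hasDerivAt_line du Complex.I).mul (hasDerivAt_line (dd hv 1) Complex.I))).const_mul 2)))
  rw [e1, e2, fderiv_symm hu 1 Complex.I, fderiv_symm hv 1 Complex.I]
  simp only [Rem, laplacian, zero_smul, add_zero, Pi.mul_apply, Pi.add_apply, Pi.sub_apply]
  ring
end horm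

lemma laplacian_continuousOn {φ : ℂ → ℝ} (hφ : ContDiffOn ℝ 2 φ unitDisc) :
    ContinuousOn (laplacian φ) unitDisc := by
  intro z hz
  have h := hφ.contDiffAt (isOpen_unitDisc.mem_nhds hz)
  have h1 : ∀ a : ℂ, ContinuousAt (fun w => fderiv ℝ (fun w => fderiv ℝ φ w a) w a) z := fun a =>
    (((contDiffAt_fderiv_apply h a).fderiv_right (m := 0) (by norm_num)).clm_apply
      contDiffAt_const).continuousAt
  exact ((h1 1).add (h1 Complex.I)).continuousWithinAt

lemma fderiv_zero_of_notMem {V : Type*} [NormedAddCommGroup V] [NormedSpace ℝ V] {b : ℂ → V} {z : ℂ}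
    (hz : z ∉ tsupport b) : fderiv ℝ b z = 0 :=
  Function.notMem_support.1 (fun h => hz (support_fderiv_subset ℝ h))

lemma dbar_zero_of_notMem {b : ℂ → ℂ} {z : ℂ} (hz : z ∉ tsupport b) : dbar b z = 0 := by
  simp [dbar, fderiv_zero_of_notMem hz]

lemma dbar_continuous {b : ℂ → ℂ} (hb : ContDiff ℝ 1 b) : Continuous (dbar b) := by
  have h := hb.continuous_fderiv (by norm_num)
  unfold dbar
  fun_prop

lemma dbar_continuousOn {b : ℂ → ℂ} (hb : ContDiffOn ℝ 1 b unitDisc) :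
    ContinuousOn (dbar b) unitDisc := by
  have h := hb.continuousOn_fderiv_of_isOpen isOpen_unitDisc le_rfl
  unfold dbar
  fun_prop

lemma csupp_lap {φ : ℂ → ℝ} (hφ : ContDiffOn ℝ 2 φ unitDisc) {b : ℂ → ℂ} (hb : ContDiff ℝ 2 b) :
    CSupp (fun z => laplacian φ z * ‖b z‖ ^ 2 * Real.exp (2 * φ z)) (tsupport b) := by
  constructor
  · have h1 := laplacian_continuousOn hφ
    have h2 := hφ.continuousOn
    have h3 := hb.continuous.continuousOn (s := unitDisc)
    fun_prop
  · intro z hz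
    simp [image_eq_zero_of_notMem_tsupport hz]

lemma csupp_dbar {φ : ℂ → ℝ} (hφ : ContDiffOn ℝ 2 φ unitDisc) {b : ℂ → ℂ} (hb : ContDiff ℝ 2 b) :
    CSupp (fun z => ‖dbar b z‖ ^ 2 * Real.exp (2 * φ z)) (tsupport b) := by
  constructor
  · have h2 := hφ.continuousOn
    have h3 := (dbar_continuous (hb.of_le (by norm_num))).continuousOn (s := unitDisc)
    fun_prop
  · intro z hz
    simp [dbar_zero_of_notMem hz]

lemma hormander_basic {φ : ℂ → ℝ} (hφ : ContDiffOn ℝ 2 φ unitDisc) {b : ℂ → ℂ}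
    (hb : ContDiff ℝ 2 b) (hc : HasCompactSupport b) (hs : tsupport b ⊆ unitDisc) :
    ∫ z, laplacian φ z * ‖b z‖ ^ 2 * Real.exp (2 * φ z) ≤
      2 * ∫ z, ‖dbar b z‖ ^ 2 * Real.exp (2 * φ z) := by
  set u : ℂ → ℝ := fun z => (b z).re with hu_def
  set v : ℂ → ℝ := fun z => (b z).im with hv_def
  have hu : ContDiff ℝ 2 u := Complex.reCLM.contDiff.comp hb
  have hv : ContDiff ℝ 2 v := Complex.imCLM.contDiff.comp hb
  have hfu : ∀ z a, fderiv ℝ u z a = (fderiv ℝ b z a).re := by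
    intro z a
    have := (Complex.reCLM.hasFDerivAt.comp z (hb.differentiable (by norm_num) z).hasFDerivAt).fderiv
    have h2 : fderiv ℝ u z = Complex.reCLM.comp (fderiv ℝ b z) := this
    rw [h2]; rfl
  have hfv : ∀ z a, fderiv ℝ v z a = (fderiv ℝ b z a).im := by
    intro z a
    have := (Complex.imCLM.hasFDerivAt.comp z (hb.differentiable (by norm_num) z).hasFDerivAt).fderiv
    have h2 : fderiv ℝ v z = Complex.imCLM.comp (fderiv ℝ b z) := this
    rw [h2]; rfl
  have hu0 : ∀ z, z ∉ tsupport b → u z = 0 := fun z hz => by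
    simp [u, image_eq_zero_of_notMem_tsupport hz]
  have hv0 : ∀ z, z ∉ tsupport b → v z = 0 := fun z hz => by
    simp [v, image_eq_zero_of_notMem_tsupport hz]
  have hat : ∀ z ∈ unitDisc, ContDiffAt ℝ 2 φ z := fun z hz =>
    hφ.contDiffAt (isOpen_unitDisc.mem_nhds hz)
  obtain ⟨c1, i1⟩ := integral_fderiv_zero hc hs (F := X1 φ u v)
    (fun z hz => (contDiffAt_X1 (hat z hz) hu.contDiffAt hv.contDiffAt).contDiffWithinAt)
    (fun z hz => by simp [X1, hu0 z hz, hv0 z hz]) 1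
  obtain ⟨c2, i2⟩ := integral_fderiv_zero hc hs (F := X2 φ u v)
    (fun z hz => (contDiffAt_X2 (hat z hz) hu.contDiffAt hv.contDiffAt).contDiffWithinAt)
    (fun z hz => by simp [X2, hu0 z hz, hv0 z hz]) Complex.I
  have hA := (csupp_dbar hφ hb).integrable hc hs
  have hB := (csupp_lap hφ hb).integrable hc hs
  have hpt : ∀ z, 2 * (laplacian φ z * ‖b z‖ ^ 2 * Real.exp (2 * φ z)) +
      (fderiv ℝ (X1 φ u v) z 1 + fderiv ℝ (X2 φ u v) z Complex.I) ≤
      4 * (‖dbar b z‖ ^ 2 * Real.exp (2 * φ z)) := by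
    intro z
    by_cases hz : z ∈ tsupport b
    · have hid := horm_identity (hat z (hs hz)) hu.contDiffAt hv.contDiffAt (u := u) (v := v)
      have hR : 0 ≤ Rem φ u v z := by unfold Rem; positivity
      have hb2 : ‖b z‖ ^ 2 = u z * u z + v z * v z := by
        rw [← Complex.normSq_eq_norm_sq, Complex.normSq_apply]
      have hd2 : ‖dbar b z‖ ^ 2 = ((fderiv ℝ u z 1 - fderiv ℝ v z Complex.I) ^ 2 +
          (fderiv ℝ u z Complex.I + fderiv ℝ v z 1) ^ 2) / 4 := by
        rw [← Complex.normSq_eq_norm_sq, Complex.normSq_apply, hfu, hfu, hfv, hfv]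
        simp only [dbar, Complex.div_re, Complex.div_im, Complex.add_re, Complex.add_im,
          Complex.mul_re, Complex.mul_im, Complex.I_re, Complex.I_im]
        norm_num [Complex.normSq]
        ring
      rw [hb2, hd2]
      nlinarith
    · have e1 : fderiv ℝ (X1 φ u v) z 1 = 0 := c1.zero z hz
      have e2 : fderiv ℝ (X2 φ u v) z Complex.I = 0 := c2.zero z hz
      rw [e1, e2, image_eq_zero_of_notMem_tsupport hz, dbar_zero_of_notMem hz]
      simp
  have hC1 := c1.integrable hc hs
  have hC2 := c2.integrable hc hs
  have hmono := integral_mono ((hB.const_mul 2).add (hC1.add hC2)) (hA.const_mul 4) hpt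
  rw [integral_add' (hB.const_mul 2) (hC1.add hC2), integral_add' hC1 hC2, i1, i2,
    integral_const_mul, integral_const_mul] at hmono
  linarith

lemma hasFDerivAt_normSq (z : ℂ) :
    ∃ L : ℂ →L[ℝ] ℝ, HasFDerivAt (fun z : ℂ => Complex.normSq z) L z ∧
      ∀ v, L v = 2 * (z.re * v.re + z.im * v.im) := by
  have h1 : HasFDerivAt (fun z : ℂ => z.re) Complex.reCLM z := Complex.reCLM.hasFDerivAt
  have h2 : HasFDerivAt (fun z : ℂ => z.im) Complex.imCLM z := Complex.imCLM.hasFDerivAt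
  refine ⟨_, (h1.mul h1).add (h2.mul h2), ?_⟩
  intro v
  simp
  ring

lemma contDiff_normSq : ContDiff ℝ 2 (fun z : ℂ => Complex.normSq z) := by
  have h1 : ContDiff ℝ 2 (fun z : ℂ => z.re) := Complex.reCLM.contDiff
  have h2 : ContDiff ℝ 2 (fun z : ℂ => z.im) := Complex.imCLM.contDiff
  exact (h1.mul h1).add (h2.mul h2)

lemma dbar_eq_of_hasFDerivAt {b : ℂ → ℂ} {z : ℂ} {L : ℂ →L[ℝ] ℂ} (h : HasFDerivAt b L z) :
    dbar b z = (L 1 + Complex.I * L Complex.I) / 2 := by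
  simp [dbar, h.fderiv]

lemma test_hol {G : ℝ → ℝ} (hG : ContDiff ℝ 2 G) {r : ℝ} (hr : r < 1) (hGr : ∀ s, r ≤ s → G s = 0)
    {h : ℂ → ℂ} {U : Set ℂ} (hU : IsOpen U) (hh : DifferentiableOn ℂ h U)
    (h0 : ∀ z, z ∉ U → ∀ᶠ s in nhds (Complex.normSq z), G s = 0) :
    ContDiff ℝ 2 (fun z => (G (Complex.normSq z) : ℂ) * h z) ∧
    HasCompactSupport (fun z => (G (Complex.normSq z) : ℂ) * h z) ∧
    tsupport (fun z => (G (Complex.normSq z) : ℂ) * h z) ⊆ unitDisc ∧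
    ∀ z, dbar (fun z => (G (Complex.normSq z) : ℂ) * h z) z =
      ((deriv G (Complex.normSq z) : ℝ) : ℂ) * (z * h z) := by
  have hev : ∀ z, z ∉ U → (fun z => (G (Complex.normSq z) : ℂ) * h z) =ᶠ[nhds z] fun _ => 0 := by
    intro z hz
    have := (contDiff_normSq.continuous.tendsto z).eventually (h0 z hz)
    filter_upwards [this] with w hw
    simp [hw]
  have hGc : ContDiff ℝ 2 (fun z : ℂ => (G (Complex.normSq z) : ℂ)) :=
    Complex.ofRealCLM.contDiff.comp (hG.comp contDiff_normSq)
  have hz : ∀ z, z ∉ Metric.closedBall (0 : ℂ) (Real.sqrt r) →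
      (fun z => (G (Complex.normSq z) : ℂ) * h z) z = 0 := by
    intro z hz
    rw [mem_closedBall_zero_iff, not_le] at hz
    have : r ≤ Complex.normSq z := by
      rw [Complex.normSq_eq_norm_sq]
      exact (Real.sqrt_le_left (norm_nonneg z)).1 hz.le
    simp [hGr _ this]
  refine ⟨?_, ?_, ?_, ?_⟩
  · rw [contDiff_iff_contDiffAt]
    intro z
    by_cases hzU : z ∈ U
    · have h1 : ContDiffAt ℂ 2 h z := (hh.contDiffOn hU).contDiffAt (hU.mem_nhds hzU)
      exact hGc.contDiffAt.mul (h1.restrict_scalars ℝ)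
    · exact contDiffAt_const.congr_of_eventuallyEq (hev z hzU)
  · exact HasCompactSupport.intro (isCompact_closedBall _ _) hz
  · refine (closure_minimal (t := Metric.closedBall (0 : ℂ) (Real.sqrt r)) ?_
      Metric.isClosed_closedBall).trans ?_
    · intro z hz1
      by_contra hcon
      exact hz1 (hz z hcon)
    · apply Metric.closedBall_subset_ball
      rw [Real.sqrt_lt' (by norm_num)]
      linarith
  · intro z
    by_cases hzU : z ∈ U
    · have h1 : HasDerivAt h (deriv h z) z :=
        (hh.differentiableAt (hU.mem_nhds hzU)).hasDerivAt
      have h2 := h1.hasFDerivAt.restrictScalars ℝ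
      obtain ⟨L, hL, hLv⟩ := hasFDerivAt_normSq z
      have h3 : HasDerivAt G (deriv G (Complex.normSq z)) (Complex.normSq z) :=
        (hG.differentiable (by norm_num) _).hasDerivAt
      have h4 := Complex.ofRealCLM.hasFDerivAt.comp z (h3.comp_hasFDerivAt z hL)
      have h5 := h4.mul h2
      have h6 := dbar_eq_of_hasFDerivAt h5
      refine Eq.trans h6 ?_
      simp [hLv]
      apply Complex.ext <;> simp <;> ring
    · have e1 : dbar (fun z => (G (Complex.normSq z) : ℂ) * h z) z = 0 := by
        simp [dbar, (hev z hzU).fderiv_eq]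
      have e2 : deriv G (Complex.normSq z) = 0 := by
        rw [(show G =ᶠ[nhds (Complex.normSq z)] fun _ => 0 from h0 z hzU).deriv_eq]
        simp
      rw [e1, e2]; simp

lemma contDiff_primitive {K : ℝ → ℝ} (hK : ContDiff ℝ 1 K) (a : ℝ) :
    ContDiff ℝ 2 (fun s => ∫ t in a..s, K t) ∧ deriv (fun s => ∫ t in a..s, K t) = K := by
  have hd : deriv (fun s => ∫ t in a..s, K t) = K := by
    funext s
    exact hK.continuous.deriv_integral K a s
  refine ⟨?_, hd⟩
  rw [show (2 : WithTop ℕ∞) = 1 + 1 by norm_num, contDiff_succ_iff_deriv]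
  refine ⟨?_, by simp, by rwa [hd]⟩
  intro s
  exact (intervalIntegral.integral_hasDerivAt_right (hK.continuous.intervalIntegrable _ _)
    (hK.continuous.stronglyMeasurableAtFilter _ _) hK.continuous.continuousAt).differentiableAt

section
variable {y : ℂ → ℂ}
  (ha : ∀ b : ℂ → ℂ, ContDiff ℝ 2 b → HasCompactSupport b → tsupport b ⊆ unitDisc →
    ∫ z, dbar b z * y z = 0)
include ha

lemma moment_pos {K : ℝ → ℝ} (hK : ContDiff ℝ 1 K) {r : ℝ} (hr : r < 1)
    (hKr : ∀ s, r ≤ s → K s = 0) (n : ℕ) :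
    ∫ z, (K (Complex.normSq z) : ℂ) * z ^ (n + 1) * y z = 0 := by
  obtain ⟨h1, h2⟩ := contDiff_primitive hK r
  obtain ⟨t1, t2, t3, t4⟩ := test_hol h1 hr (fun s hs => by
    apply intervalIntegral.integral_zero_ae
    refine Eventually.of_forall fun t ht => ?_
    rw [uIoc_of_le hs] at ht
    exact hKr t ht.1.le) (h := fun z => z ^ n) isOpen_univ (by fun_prop) (by simp)
  have := ha _ t1 t2 t3
  rw [← this]
  refine integral_congr_ae (Eventually.of_forall fun z => ?_)
  simp only
  rw [t4, h2]
  ring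

lemma moment_neg {K : ℝ → ℝ} (hK : ContDiff ℝ 1 K) {ε r : ℝ} (hε : 0 < ε) (hr : r < 1)
    (hKr : ∀ s, r ≤ s → K s = 0) (hKε : ∀ s, s ≤ ε → K s = 0) (m : ℕ)
    (hm : ∫ s in (0:ℝ)..1, s ^ m * K s = 0) :
    ∫ z, (K (Complex.normSq z) : ℂ) * (starRingEnd ℂ z) ^ m * y z = 0 := by
  have hK' : ContDiff ℝ 1 (fun s => s ^ m * K s) := by fun_prop
  obtain ⟨h1, h2⟩ := contDiff_primitive hK' 0
  have hz0 : ∀ s, s ≤ ε → ∫ t in (0:ℝ)..s, t ^ m * K t = 0 := by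
    intro s hs
    apply intervalIntegral.integral_zero_ae
    refine Eventually.of_forall fun t ht => ?_
    have : t ≤ ε := by
      rcases le_total 0 s with h | h
      · rw [uIoc_of_le h] at ht; exact ht.2.trans hs
      · rw [uIoc_of_ge h] at ht; exact ht.2.trans hε.le
    rw [hKε t this, mul_zero]
  have hz1 : ∀ s, r ≤ s → ∫ t in (0:ℝ)..s, t ^ m * K t = 0 := by
    intro s hs
    have hi : ∀ a b : ℝ, IntervalIntegrable (fun s => s ^ m * K s) volume a b := fun a b =>
      hK'.continuous.intervalIntegrable _ _
    rw [← intervalIntegral.integral_add_adjacent_intervals (hi 0 1) (hi 1 s), hm, zero_add]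
    apply intervalIntegral.integral_zero_ae
    refine Eventually.of_forall fun t ht => ?_
    have : r ≤ t := by
      rcases le_total 1 s with h | h
      · rw [uIoc_of_le h] at ht; linarith [ht.1]
      · rw [uIoc_of_ge h] at ht; linarith [ht.1]
    rw [hKr t this, mul_zero]
  obtain ⟨t1, t2, t3, t4⟩ := test_hol h1 hr hz1 (h := fun z => (z ^ (m + 1))⁻¹) (U := {0}ᶜ)
    isOpen_compl_singleton (by
      intro z hz
      exact (((differentiable_pow (𝕜 := ℂ) (m+1)).differentiableAt (x := z)).inv
        (pow_ne_zero _ hz)).differentiableWithinAt) (by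
      intro z hz
      simp only [mem_compl_iff, mem_singleton_iff, not_not] at hz
      subst hz
      rw [map_zero]
      filter_upwards [Iio_mem_nhds hε] with s hs
      exact hz0 s (le_of_lt hs))
  have := ha _ t1 t2 t3
  rw [← this]
  refine integral_congr_ae (Eventually.of_forall fun z => ?_)
  simp only
  rw [t4, h2]
  by_cases hz : z = 0
  · subst hz
    simp [hKε 0 hε.le]
  · have : (Complex.normSq z : ℂ) = z * starRingEnd ℂ z := (Complex.mul_conj z).symm
    push_cast
    rw [this]
    field_simp
    rw [mul_pow]; ring
end

lemma exists_cutoffs : ∃ χ : ℕ → ℝ → ℝ, (∀ k, ContDiff ℝ 1 (χ k)) ∧ (∀ k s, 0 ≤ χ k s ∧ χ k s ≤ 1) ∧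
    (∀ k, ∀ s ∈ Icc (1/4 : ℝ) (3/4), χ k s = 1) ∧
    (∀ k, ∃ ε > 0, ε < 1 ∧ (∀ s, s ≤ ε → χ k s = 0) ∧ (∀ s, 1 - ε ≤ s → χ k s = 0)) ∧
    (∀ s ∈ Ioo (0 : ℝ) 1, ∀ᶠ k in atTop, χ k s = 1) := by
  have hpos : ∀ k : ℕ, (0:ℝ) < 1 / (k + 8) := fun k => by positivity
  have hle : ∀ k : ℕ, (1:ℝ) / (k + 8) ≤ 1 / 8 := fun k => by
    apply one_div_le_one_div_of_le <;> linarith [Nat.cast_nonneg (α := ℝ) k]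
  let β : ∀ k : ℕ, ContDiffBump (1/2 : ℝ) := fun k =>
    ⟨1/2 - 2 * (1 / (k + 8)), 1/2 - 1 / (k + 8), by linarith [hle k], by linarith [hpos k]⟩
  refine ⟨fun k => β k, fun k => (β k).contDiff, fun k s => ⟨(β k).nonneg, (β k).le_one⟩, ?_, ?_, ?_⟩
  · intro k s hs
    apply (β k).one_of_mem_closedBall
    rw [Metric.mem_closedBall, Real.dist_eq, abs_le]
    have := hle k
    constructor <;> simp only [β] <;> linarith [hs.1, hs.2]
  · intro k
    refine ⟨1 / (k+8), hpos k, by linarith [hle k], ?_, ?_⟩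
    · intro s hs
      apply (β k).zero_of_le_dist
      rw [Real.dist_eq]
      have := neg_abs_le (s - 1/2)
      simp only [β]; linarith
    · intro s hs
      apply (β k).zero_of_le_dist
      rw [Real.dist_eq]
      have := le_abs_self (s - 1/2)
      simp only [β]; linarith
  · intro s hs
    have h1 : Tendsto (fun k : ℕ => (1:ℝ) / (k + 8)) atTop (nhds 0) := by
      have := (tendsto_const_div_atTop_nhds_zero_nat (1:ℝ)).comp (tendsto_add_atTop_nat 8)
      refine this.congr fun k => ?_
      simp
    have h2 := h1.eventually (Iio_mem_nhds (show (0:ℝ) < min s (1-s) / 2 by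
      have := lt_min hs.1 (sub_pos.2 hs.2); linarith))
    filter_upwards [h2] with k hk
    apply (β k).one_of_mem_closedBall
    rw [Metric.mem_closedBall, Real.dist_eq, abs_le]
    have h3 : (1:ℝ) / (k + 8) < min s (1-s) / 2 := hk
    have := min_le_left s (1-s)
    have := min_le_right s (1-s)
    constructor <;> simp only [β] <;> linarith

section
variable {y : ℂ → ℂ}
  (ha : ∀ b : ℂ → ℂ, ContDiff ℝ 2 b → HasCompactSupport b → tsupport b ⊆ unitDisc →
    ∫ z, dbar b z * y z = 0)
  (hloc : ∀ r < 1, IntegrableOn y (Metric.closedBall 0 r))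
  (hy0 : ∀ z, z ∉ unitDisc → y z = 0)

include hloc hy0 in
lemma integrable_K_mul {K : ℝ → ℝ} (hK : Continuous K) {r : ℝ} (hr : r < 1)
    (hKr : ∀ s, r ≤ s → K s = 0) {h : ℂ → ℂ} (hh : Continuous h) :
    Integrable (fun z => (K (Complex.normSq z) : ℂ) * h z * y z) := by
  have h0 : ∀ z, z ∉ Metric.closedBall (0 : ℂ) (Real.sqrt r) →
      (K (Complex.normSq z) : ℂ) * h z * y z = 0 := by
    intro z hz
    rw [mem_closedBall_zero_iff, not_le] at hz
    have : r ≤ Complex.normSq z := by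
      rw [Complex.normSq_eq_norm_sq]
      exact (Real.sqrt_le_left (norm_nonneg z)).1 hz.le
    simp [hKr _ this]
  have h1 : Real.sqrt r < 1 := by
      rw [Real.sqrt_lt' (by norm_num)]
      linarith
  have h2 : IntegrableOn (fun z => (K (Complex.normSq z) : ℂ) * h z * y z)
      (Metric.closedBall (0 : ℂ) (Real.sqrt r)) := by
    have hc : Continuous (fun z => (K (Complex.normSq z) : ℂ) * h z) :=
      (Complex.continuous_ofReal.comp (hK.comp contDiff_normSq.continuous)).mul hh
    exact (hloc _ h1).continuousOn_mul hc.continuousOn (isCompact_closedBall _ _)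
  exact (integrableOn_iff_integrable_of_support_subset (fun z hz => by
    by_contra hcon
    exact hz (h0 z hcon))).1 h2

variable {W : ℝ → ℝ} (hWpos : ∀ s ∈ Ioo (0:ℝ) 1, 0 < W s) (hWc : ContDiffOn ℝ 1 W (Ioo 0 1))
  (hWi : Integrable (fun z => (W (Complex.normSq z) : ℂ) * y z))
  (hWm : ∀ m : ℕ, ∫ z, (W (Complex.normSq z) : ℂ) * (starRingEnd ℂ z) ^ m * y z = 0)

include ha hloc hy0 hWpos hWc hWi hWm

lemma moment_zero {K : ℝ → ℝ} (hK : ContDiff ℝ 1 K) {ε r : ℝ} (hε : 0 < ε) (hr : r < 1)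
    (hKr : ∀ s, r ≤ s → K s = 0) (hKε : ∀ s, s ≤ ε → K s = 0) (m : ℕ) :
    ∫ z, (K (Complex.normSq z) : ℂ) * (starRingEnd ℂ z) ^ m * y z = 0 := by
  obtain ⟨χ, hχ1, hχ2, hχ3, hχ4, hχ5⟩ := exists_cutoffs
  have hcC : ∀ k, ContDiff ℝ 1 (fun s => χ k s * W s) := by
    intro k
    obtain ⟨e, he0, he1, hz1, hz2⟩ := hχ4 k
    rw [contDiff_iff_contDiffAt]
    intro s
    by_cases hs : s ∈ Ioo (0:ℝ) 1
    · exact (hχ1 k).contDiffAt.mul (hWc.contDiffAt (Ioo_mem_nhds hs.1 hs.2))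
    · refine contDiffAt_const (c := (0:ℝ)) |>.congr_of_eventuallyEq ?_
      by_cases h0 : s < e
      · filter_upwards [Iio_mem_nhds h0] with t ht
        rw [hz1 t (le_of_lt ht), zero_mul]
      · have : 1 - e < s := by
          by_contra hcon
          exact hs ⟨by linarith, by linarith⟩
        filter_upwards [Ioi_mem_nhds this] with t ht
        rw [hz2 t (le_of_lt ht), zero_mul]
  have hnn : ∀ k, ∀ s ∈ Icc (0:ℝ) 1, 0 ≤ s ^ m * (χ k s * W s) := by
    intro k s hs
    obtain ⟨e, he0, he1, hz1, hz2⟩ := hχ4 k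
    rcases eq_or_lt_of_le hs.1 with h | h
    · rw [hz1 s (by linarith)]; simp
    rcases eq_or_lt_of_le hs.2 with h' | h'
    · rw [hz2 s (by linarith)]; simp
    exact mul_nonneg (pow_nonneg hs.1 _) (mul_nonneg (hχ2 k s).1 (hWpos s ⟨h, h'⟩).le)
  set J : ℝ := ∫ s in (1/4:ℝ)..(3/4), s ^ m * W s with hJ
  have hJpos : 0 < J := by
    apply intervalIntegral.intervalIntegral_pos_of_pos_on
    · apply ContinuousOn.intervalIntegrable
      rw [uIcc_of_le (by norm_num)]
      exact (by fun_prop : Continuous fun s : ℝ => s ^ m).continuousOn.mul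
        (hWc.continuousOn.mono fun s hs => ⟨by linarith [hs.1], by linarith [hs.2]⟩)
    · intro s hs
      exact mul_pos (pow_pos (by linarith [hs.1]) _) (hWpos s ⟨by linarith [hs.1], by linarith [hs.2]⟩)
    · norm_num
  have hci : ∀ k a b, IntervalIntegrable (fun s => s ^ m * (χ k s * W s)) volume a b := fun k a b =>
    ((by fun_prop : Continuous fun s : ℝ => s ^ m).mul (hcC k).continuous).intervalIntegrable _ _
  set c : ℕ → ℝ := fun k => ∫ s in (0:ℝ)..1, s ^ m * (χ k s * W s) with hc
  have hcJ : ∀ k, J ≤ c k := by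
    intro k
    have e : J = ∫ s in (1/4:ℝ)..(3/4), s ^ m * (χ k s * W s) := by
      apply intervalIntegral.integral_congr
      intro s hs
      rw [uIcc_of_le (by norm_num)] at hs
      simp only
      rw [hχ3 k s hs, one_mul]
    rw [e]
    apply intervalIntegral.integral_mono_interval (by norm_num) (by norm_num) (by norm_num) _ (hci k 0 1)
    filter_upwards [ae_restrict_mem measurableSet_Ioc] with s hs
    exact hnn k s ⟨hs.1.le, hs.2⟩
  set c0 : ℝ := ∫ s in (0:ℝ)..1, s ^ m * K s with hc0
  have hconj : Continuous (fun z : ℂ => (starRingEnd ℂ z) ^ m) := Complex.continuous_conj.pow m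
  set I0 := ∫ z, (K (Complex.normSq z) : ℂ) * (starRingEnd ℂ z) ^ m * y z with hI0
  have key : ∀ k, I0 = ((c0 / c k : ℝ) : ℂ) *
      ∫ z, ((χ k (Complex.normSq z) * W (Complex.normSq z) : ℝ) : ℂ) * (starRingEnd ℂ z) ^ m * y z := by
    intro k
    obtain ⟨e, he0, he1, hz1, hz2⟩ := hχ4 k
    have hck : c k ≠ 0 := (hJpos.trans_le (hcJ k)).ne'
    have := moment_neg ha (K := fun s => K s - (c0 / c k) * (χ k s * W s))
      (hK.sub (contDiff_const.mul (hcC k))) (ε := min ε e) (r := max r (1 - e)) (lt_min hε he0)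
      (max_lt hr (by linarith)) (fun s hs => by
        rw [hKr s ((le_max_left _ _).trans hs), hz2 s ((le_max_right _ _).trans hs)]; simp)
      (fun s hs => by
        rw [hKε s (hs.trans (min_le_left _ _)), hz1 s (hs.trans (min_le_right _ _))]; simp) m (by
        have e1 : ∀ s : ℝ, s ^ m * (K s - (c0 / c k) * (χ k s * W s)) =
          s ^ m * K s - (c0 / c k) * (s ^ m * (χ k s * W s)) := fun s => by ring
        simp_rw [e1]
        rw [intervalIntegral.integral_sub, intervalIntegral.integral_const_mul]
        · change c0 - c0 / c k * c k = 0
          field_simp; ring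
        · exact ((by fun_prop : Continuous fun s : ℝ => s ^ m).mul hK.continuous).intervalIntegrable _ _
        · exact (hci k 0 1).const_mul _)
    have e2 : ∀ z : ℂ, ((K (Complex.normSq z) - (c0 / c k) * (χ k (Complex.normSq z) *
        W (Complex.normSq z)) : ℝ) : ℂ) * (starRingEnd ℂ z) ^ m * y z =
        (K (Complex.normSq z) : ℂ) * (starRingEnd ℂ z) ^ m * y z - ((c0 / c k : ℝ) : ℂ) *
        (((χ k (Complex.normSq z) * W (Complex.normSq z) : ℝ) : ℂ) * (starRingEnd ℂ z) ^ m * y z) := by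
      intro z; push_cast; ring
    simp_rw [e2] at this
    rw [integral_sub, integral_const_mul, sub_eq_zero] at this
    · exact this
    · exact integrable_K_mul hloc hy0 hK.continuous hr hKr hconj
    · apply Integrable.const_mul
      exact integrable_K_mul hloc hy0 (K := fun s => χ k s * W s) (hcC k).continuous
        (r := 1 - e) (by linarith) (fun s hs => by rw [hz2 s hs, zero_mul]) hconj
  have hlim : Tendsto (fun k => ∫ z, ((χ k (Complex.normSq z) * W (Complex.normSq z) : ℝ) : ℂ) *
      (starRingEnd ℂ z) ^ m * y z) atTop (nhds 0) := by
    rw [← hWm m]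
    refine tendsto_integral_of_dominated_convergence
      (fun z => ‖(W (Complex.normSq z) : ℂ) * y z‖) ?_ hWi.norm ?_ ?_
    · intro k
      obtain ⟨e, he0, he1, hz1, hz2⟩ := hχ4 k
      exact (integrable_K_mul hloc hy0 (K := fun s => χ k s * W s) (hcC k).continuous
        (r := 1 - e) (by linarith) (fun s hs => by rw [hz2 s hs, zero_mul]) hconj).1
    · intro k
      refine Eventually.of_forall fun z => ?_
      by_cases hz : z ∈ unitDisc
      · rw [mem_unitDisc] at hz
        push_cast
        simp only [norm_mul, norm_pow, RCLike.norm_conj, Complex.norm_real, Real.norm_eq_abs]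
        rw [abs_of_nonneg (hχ2 k _).1]
        have h1 := (hχ2 k (Complex.normSq z)).2
        have h1' := (hχ2 k (Complex.normSq z)).1
        have h2 : ‖z‖ ^ m ≤ 1 := pow_le_one₀ (norm_nonneg _) hz.le
        have h3 : χ k (Complex.normSq z) * ‖z‖ ^ m ≤ 1 := mul_le_one₀ h1 (by positivity) h2
        have h4 : 0 ≤ |W (Complex.normSq z)| * ‖y z‖ := by positivity
        nlinarith
      · simp [hy0 z hz]
    · have h0 : ∀ᵐ z : ℂ, z ≠ 0 := by
        rw [ae_iff]; simp
      filter_upwards [h0] with z hz0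
      by_cases hz : z ∈ unitDisc
      · rw [mem_unitDisc] at hz
        have hs : Complex.normSq z ∈ Ioo (0:ℝ) 1 := by
          refine ⟨Complex.normSq_pos.2 hz0, ?_⟩
          rw [Complex.normSq_eq_norm_sq]
          nlinarith [norm_nonneg z]
        refine tendsto_const_nhds.congr' ?_
        filter_upwards [hχ5 _ hs] with k hk
        rw [hk, one_mul]
      · simp [hy0 z hz]
  have hlim2 : Tendsto (fun _ : ℕ => I0) atTop (nhds 0) := by
    rw [tendsto_zero_iff_norm_tendsto_zero]
    have hb : Tendsto (fun k => (|c0| / J) * ‖∫ z, ((χ k (Complex.normSq z) * W (Complex.normSq z) : ℝ) : ℂ) *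
      (starRingEnd ℂ z) ^ m * y z‖) atTop (nhds 0) := by
      simpa using (hlim.norm.const_mul (|c0| / J))
    refine squeeze_zero (fun _ => norm_nonneg _) (fun k => ?_) hb
    rw [key k, norm_mul, Complex.norm_real, Real.norm_eq_abs, abs_div,
      abs_of_pos (hJpos.trans_le (hcJ k))]
    gcongr
    exact hcJ k
  exact tendsto_nhds_unique tendsto_const_nhds hlim2

lemma moment_all {K : ℝ → ℝ} (hK : ContDiff ℝ 1 K) {ε r : ℝ} (hε : 0 < ε) (hr : r < 1)
    (hKr : ∀ s, r ≤ s → K s = 0) (hKε : ∀ s, s ≤ ε → K s = 0) (a b : ℕ) :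
    ∫ z, (K (Complex.normSq z) : ℂ) * (z ^ a * (starRingEnd ℂ z) ^ b) * y z = 0 := by
  rcases le_or_gt a b with h | h
  · obtain ⟨m, rfl⟩ := Nat.exists_eq_add_of_le h
    have := moment_zero ha hloc hy0 hWpos hWc hWi hWm (K := fun s => K s * s ^ a)
      (hK.mul (by fun_prop)) hε hr (fun s hs => by simp [hKr s hs]) (fun s hs => by simp [hKε s hs]) m
    rw [← this]
    refine integral_congr_ae (Eventually.of_forall fun z => ?_)
    simp only
    have : (Complex.normSq z : ℂ) = z * starRingEnd ℂ z := (Complex.mul_conj z).symm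
    push_cast
    rw [this]; ring
  · obtain ⟨m, rfl⟩ := Nat.exists_eq_add_of_lt h
    have := moment_pos ha (K := fun s => K s * s ^ b)
      (hK.mul (by fun_prop)) hr (fun s hs => by simp [hKr s hs]) m
    rw [← this]
    refine integral_congr_ae (Eventually.of_forall fun z => ?_)
    simp only
    have : (Complex.normSq z : ℂ) = z * starRingEnd ℂ z := (Complex.mul_conj z).symm
    push_cast
    rw [this]; ring
end

lemma sw_zero {f : ℂ → ℂ} (hf : Integrable f) (hf0 : ∀ z, z ∉ unitDisc → f z = 0)
    (h : ∀ a b : ℕ, ∫ z, (z ^ a * (starRingEnd ℂ z) ^ b) * f z = 0) : ∀ᵐ z, f z = 0 := by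
  apply ae_eq_zero_of_integral_contDiff_smul_eq_zero hf.locallyIntegrable
  intro g hg hgc
  haveI : CompactSpace (Metric.closedBall (0:ℂ) 1) :=
    isCompact_iff_compactSpace.1 (isCompact_closedBall _ _)
  -- approximations
  let Good : C(Metric.closedBall (0:ℂ) 1, ℂ) → Prop := fun u =>
    ∃ U : ℂ → ℂ, Continuous U ∧ (∀ x : Metric.closedBall (0:ℂ) 1, U x = u x) ∧ ∫ z, U z * f z = 0
  have hInteg : ∀ U : ℂ → ℂ, Continuous U → Integrable (fun z => U z * f z) := by
    intro U hU
    have h2 : IntegrableOn (fun z => U z * f z) (Metric.closedBall (0 : ℂ) 1) :=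
      hf.integrableOn.continuousOn_mul hU.continuousOn (isCompact_closedBall _ _)
    refine (integrableOn_iff_integrable_of_support_subset (fun z hz => ?_)).1 h2
    by_contra hcon
    apply hz
    have : f z = 0 := hf0 z fun hz2 => hcon (Metric.ball_subset_closedBall hz2)
    rw [this, mul_zero]
  have hgood : ∀ u ∈ (polynomialFunctions (Metric.closedBall (0:ℂ) 1)).starClosure, Good u := by
    intro u hu
    rw [polynomialFunctions.starClosure_eq_adjoin_X] at hu
    have hu' : u ∈ (StarAlgebra.adjoin ℂ {Polynomial.toContinuousMapOnAlgHom (Metric.closedBall (0:ℂ) 1) Polynomial.X}).toSubalgebra := hu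
    rw [StarAlgebra.adjoin_toSubalgebra, Set.star_singleton, Set.singleton_union,
      ← Subalgebra.mem_toSubmodule, Algebra.adjoin_eq_span] at hu'
    clear hu
    induction hu' using Submodule.span_induction with
    | mem x hx =>
      obtain ⟨a, b, hab⟩ := (Submonoid.mem_closure_pair _ _ _).1 hx
      refine ⟨fun z => z ^ a * (starRingEnd ℂ z) ^ b, ?_, ?_, h a b⟩
      · exact (continuous_pow a).mul (Complex.continuous_conj.pow b)
      · intro z
        rw [← hab]
        simp
    | zero => exact ⟨0, continuous_zero, by simp, by simp⟩
    | add x y _ _ hx hy =>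
      obtain ⟨U, h1, h2, h3⟩ := hx
      obtain ⟨V, h1', h2', h3'⟩ := hy
      refine ⟨fun z => U z + V z, h1.add h1', fun z => by simp [h2, h2'], ?_⟩
      simp_rw [add_mul]
      rw [integral_add (hInteg U h1) (hInteg V h1'), h3, h3', add_zero]
    | smul c x _ hx =>
      obtain ⟨U, h1, h2, h3⟩ := hx
      refine ⟨fun z => c * U z, continuous_const.mul h1, fun z => by simp [h2], ?_⟩
      simp_rw [mul_assoc]
      rw [integral_const_mul, h3, mul_zero]
  let G : C(Metric.closedBall (0:ℂ) 1, ℂ) :=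
    ⟨fun x => (g x : ℂ), Complex.continuous_ofReal.comp (hg.continuous.comp continuous_subtype_val)⟩
  have hG : G ∈ (polynomialFunctions (Metric.closedBall (0:ℂ) 1)).starClosure.topologicalClosure := by
    rw [polynomialFunctions.starClosure_topologicalClosure]; trivial
  have hG' : G ∈ closure ((polynomialFunctions (Metric.closedBall (0:ℂ) 1)).starClosure : Set _) := hG
  rw [Metric.mem_closure_iff] at hG'
  have hgc2 : Continuous fun z => (g z : ℂ) := Complex.continuous_ofReal.comp hg.continuous
  have hbd : ∀ ε > 0, ‖∫ z, (g z : ℂ) * f z‖ ≤ ε * ∫ z, ‖f z‖ := by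
    intro ε hε
    obtain ⟨u, hu, hd⟩ := hG' ε hε
    obtain ⟨U, h1, h2, h3⟩ := hgood u hu
    have e : ∫ z, (g z : ℂ) * f z = ∫ z, ((g z : ℂ) * f z - U z * f z) := by
      rw [integral_sub (hInteg _ hgc2) (hInteg U h1), h3, sub_zero]
    rw [e, ← integral_const_mul]
    refine norm_integral_le_of_norm_le (hf.norm.const_mul ε) (Eventually.of_forall fun z => ?_)
    by_cases hz : z ∈ unitDisc
    · rw [← sub_mul, norm_mul]
      gcongr
      have := (ContinuousMap.dist_apply_le_dist (f := G) (g := u)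
        ⟨z, Metric.ball_subset_closedBall hz⟩).trans hd.le
      rw [← h2, dist_eq_norm] at this
      exact this
    · simp [hf0 z hz]
  have hz : ‖∫ z, (g z : ℂ) * f z‖ ≤ 0 := by
    apply le_of_forall_pos_le_add
    intro ε hε
    have hI : 0 ≤ ∫ z, ‖f z‖ := integral_nonneg fun _ => norm_nonneg _
    refine (hbd (ε / (1 + ∫ z, ‖f z‖)) (by positivity)).trans ?_
    rw [zero_add, div_mul_eq_mul_div, div_le_iff₀ (by positivity)]
    nlinarith
  have := norm_le_zero_iff.1 hz
  rw [← this]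
  rfl

/-- completeness lemma -/
lemma completeness {y : ℂ → ℂ}
    (ha : ∀ b : ℂ → ℂ, ContDiff ℝ 2 b → HasCompactSupport b → tsupport b ⊆ unitDisc →
      ∫ z, dbar b z * y z = 0)
    (hloc : ∀ r < 1, IntegrableOn y (Metric.closedBall 0 r))
    (hy0 : ∀ z, z ∉ unitDisc → y z = 0)
    {W : ℝ → ℝ} (hWpos : ∀ s ∈ Ioo (0:ℝ) 1, 0 < W s) (hWc : ContDiffOn ℝ 1 W (Ioo 0 1))
    (hWi : Integrable (fun z => (W (Complex.normSq z) : ℂ) * y z))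
    (hWm : ∀ m : ℕ, ∫ z, (W (Complex.normSq z) : ℂ) * (starRingEnd ℂ z) ^ m * y z = 0) :
    ∀ᵐ z, y z = 0 := by
  obtain ⟨χ, hχ1, hχ2, hχ3, hχ4, hχ5⟩ := exists_cutoffs
  have key : ∀ k, ∀ᵐ z, (χ k (Complex.normSq z) : ℂ) * y z = 0 := by
    intro k
    obtain ⟨e, he0, he1, hz1, hz2⟩ := hχ4 k
    apply sw_zero
    · simpa using integrable_K_mul hloc hy0 (hχ1 k).continuous (r := 1 - e) (by linarith) hz2
        (h := fun _ => 1) continuous_const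
    · intro z hz; simp [hy0 z hz]
    · intro a b
      rw [← moment_all ha hloc hy0 hWpos hWc hWi hWm (hχ1 k) he0 (r := 1 - e) (by linarith) hz2 hz1 a b]
      refine integral_congr_ae (Eventually.of_forall fun z => ?_)
      simp only; ring
  have h0 : ∀ᵐ z : ℂ, z ≠ 0 := by
    rw [ae_iff]; simp
  filter_upwards [ae_all_iff.2 key, h0] with z hz hz0
  by_cases hzD : z ∈ unitDisc
  · rw [mem_unitDisc] at hzD
    have hs : Complex.normSq z ∈ Ioo (0:ℝ) 1 := by
      refine ⟨Complex.normSq_pos.2 hz0, ?_⟩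
      rw [Complex.normSq_eq_norm_sq]
      nlinarith [norm_nonneg z]
    obtain ⟨k, hk⟩ := (hχ5 _ hs).exists
    have := hz k
    rw [hk] at this
    simpa using this
  · exact hy0 z hzD

section
variable {ω φ : ℂ → ℝ} {τ : ℝ → ℝ} (hW : IsClassW ω φ τ)
include hW

lemma omega_continuousOn : ContinuousOn ω unitDisc := by
  have h : ContinuousOn (fun z => Real.exp (-(2 * φ z))) unitDisc := by
    have := hW.smooth.continuousOn
    fun_prop
  exact h.congr hW.omega_eq

lemma dA_restrict : dA.restrict unitDisc =
    (ENNReal.ofReal Real.pi)⁻¹ • (volume : Measure ℂ).restrict unitDisc := by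
  rw [dA, Measure.restrict_smul]

lemma dA_const_ne : (ENNReal.ofReal Real.pi)⁻¹ ≠ 0 ∧ (ENNReal.ofReal Real.pi)⁻¹ ≠ ⊤ := by
  constructor
  · simp
  · simp [Real.pi_pos]

lemma ae_dA_iff {P : ℂ → Prop} : (∀ᵐ z ∂(dA.restrict unitDisc), P z) ↔
    ∀ᵐ z ∂((volume : Measure ℂ).restrict unitDisc), P z := by
  rw [dA_restrict hW]
  exact Measure.ae_ennreal_smul_measure_iff (dA_const_ne hW).1

lemma aem_omega : AEMeasurable (fun z => ENNReal.ofReal (ω z)) (dA.restrict unitDisc) := by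
  apply AEMeasurable.ennreal_ofReal
  exact (omega_continuousOn hW).aemeasurable isOpen_unitDisc.measurableSet

lemma ae_muW_iff {P : ℂ → Prop} : (∀ᵐ z ∂(muW ω), P z) ↔
    ∀ᵐ z ∂((volume : Measure ℂ).restrict unitDisc), P z := by
  rw [muW, ae_withDensity_iff' (aem_omega hW), ae_dA_iff hW]
  constructor
  · intro h
    filter_upwards [h, ae_restrict_mem isOpen_unitDisc.measurableSet] with z hz hzD
    exact hz (by simpa using hW.pos z hzD)
  · intro h
    filter_upwards [h] with z hz _ using hz

lemma muW_ac : muW ω ≪ (volume : Measure ℂ).restrict unitDisc := by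
  refine Measure.AbsolutelyContinuous.mk fun s _ hs => ?_
  have h1 : ∀ᵐ z ∂((volume : Measure ℂ).restrict unitDisc), z ∉ s := by
    rw [ae_iff]; simpa using hs
  have := (ae_muW_iff hW).2 h1
  rw [ae_iff] at this
  simpa using this

lemma ac_muW : (volume : Measure ℂ).restrict unitDisc ≪ muW ω := by
  refine Measure.AbsolutelyContinuous.mk fun s _ hs => ?_
  have h1 : ∀ᵐ z ∂(muW ω), z ∉ s := by
    rw [ae_iff]; simpa using hs
  have := (ae_muW_iff hW).1 h1
  rw [ae_iff] at this
  simpa using this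

lemma aesm_muW_iff {f : ℂ → ℂ} : AEStronglyMeasurable f (muW ω) ↔
    AEStronglyMeasurable f ((volume : Measure ℂ).restrict unitDisc) :=
  ⟨fun h => h.mono_ac (ac_muW hW), fun h => h.mono_ac (muW_ac hW)⟩

lemma mem_unitDisc_ae : ∀ᵐ z ∂(muW ω), z ∈ unitDisc :=
  (ae_muW_iff hW).2 (ae_restrict_mem isOpen_unitDisc.measurableSet)

lemma integral_muW {E : Type*} [NormedAddCommGroup E] [NormedSpace ℝ E] (f : ℂ → E) :
    ∫ z, f z ∂(muW ω) = Real.pi⁻¹ • ∫ z in unitDisc, ω z • f z := by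
  rw [muW, integral_withDensity_eq_integral_toReal_smul₀ (aem_omega hW) (by simp),
    dA_restrict hW, integral_smul_measure]
  congr 1
  · rw [ENNReal.toReal_inv, ENNReal.toReal_ofReal Real.pi_pos.le]
  · apply setIntegral_congr_fun isOpen_unitDisc.measurableSet
    intro z hz
    simp only
    rw [ENNReal.toReal_ofReal (hW.pos z hz).le]

lemma integrable_muW {E : Type*} [NormedAddCommGroup E] [NormedSpace ℝ E] (f : ℂ → E) :
    Integrable f (muW ω) ↔ IntegrableOn (fun z => ω z • f z) unitDisc := by
  rw [muW, integrable_withDensity_iff_integrable_smul₀' (aem_omega hW) (by simp),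
    dA_restrict hW, integrable_smul_measure (dA_const_ne hW).1 (dA_const_ne hW).2]
  apply integrableOn_congr_fun (s := unitDisc) _ isOpen_unitDisc.measurableSet
  intro z hz
  simp only
  rw [ENNReal.toReal_ofReal (hW.pos z hz).le]

lemma lintegral_muW {f : ℂ → ℝ≥0∞} (hf : AEMeasurable f ((volume : Measure ℂ).restrict unitDisc)) :
    ∫⁻ z, f z ∂(muW ω) = ∫⁻ z in unitDisc, ENNReal.ofReal (ω z) * f z ∂dA := by
  rw [muW, lintegral_withDensity_eq_lintegral_mul₀ (aem_omega hW)]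
  · rfl
  · rw [dA_restrict hW]; exact hf.smul_measure _

lemma muW_finite : IsFiniteMeasure (muW ω) := by
  constructor
  rw [muW, withDensity_apply _ MeasurableSet.univ, Measure.restrict_univ]
  exact hW.integrable

/-- Bounded continuous functions on the disc are in L². -/
lemma memLp_bdd {f : ℂ → ℂ} (hf : ContinuousOn f unitDisc) (M : ℝ)
    (hM : ∀ z ∈ unitDisc, ‖f z‖ ≤ M) : MemLp f 2 (muW ω) := by
  have := muW_finite hW
  refine MemLp.of_bound ?_ M ?_
  · rw [aesm_muW_iff hW]
    exact hf.aestronglyMeasurable isOpen_unitDisc.measurableSet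
  · filter_upwards [mem_unitDisc_ae hW] with z hz using hM z hz

lemma memLp_csupp {f : ℂ → ℂ} {K : Set ℂ} (hf : CSupp f K) (hK : IsCompact K) (hKD : K ⊆ unitDisc) :
    MemLp f 2 (muW ω) := by
  obtain ⟨M, hM⟩ := (hf.hasCompactSupport hK).exists_bound_of_continuous (hf.continuous hK hKD)
  exact memLp_bdd hW hf.cont M fun z _ => hM z

end

/-- C² test functions with compact support in the disc -/
def IsTest (b : ℂ → ℂ) : Prop :=
  ContDiff ℝ 2 b ∧ HasCompactSupport b ∧ tsupport b ⊆ unitDisc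

lemma dbar_add' {a b : ℂ → ℂ} {z : ℂ} (ha : DifferentiableAt ℝ a z) (hb : DifferentiableAt ℝ b z) :
    dbar (fun z => a z + b z) z = dbar a z + dbar b z := by
  refine (dbar_eq_of_hasFDerivAt (ha.hasFDerivAt.add hb.hasFDerivAt)).trans ?_
  simp [dbar]; ring

lemma dbar_const_mul' {a : ℂ → ℂ} {z : ℂ} (c : ℂ) (ha : DifferentiableAt ℝ a z) :
    dbar (fun z => c * a z) z = c * dbar a z := by
  rw [dbar_eq_of_hasFDerivAt (ha.hasFDerivAt.const_mul c)]
  simp [dbar]; ring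

lemma dbar_mul_hol {a p : ℂ → ℂ} {z : ℂ} (ha : DifferentiableAt ℝ a z) (hp : DifferentiableAt ℂ p z) :
    dbar (fun z => a z * p z) z = dbar a z * p z := by
  refine (dbar_eq_of_hasFDerivAt (ha.hasFDerivAt.mul
    ((hp.hasDerivAt.hasFDerivAt).restrictScalars ℝ))).trans ?_
  simp only [dbar]
  simp
  linear_combination (-(1/2) * a z * deriv p z) * (-Complex.I_sq)

lemma dbar_hol {p : ℂ → ℂ} {z : ℂ} (hp : DifferentiableAt ℂ p z) : dbar p z = 0 := by
  rw [dbar_eq_of_hasFDerivAt ((hp.hasDerivAt.hasFDerivAt).restrictScalars ℝ)]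
  simp
  have := Complex.I_mul_I
  rw [← mul_assoc, this]; ring

/-- The function `e^{2φ} conj(∂̄ b)` -/
def sFun (φ : ℂ → ℝ) (b : ℂ → ℂ) (z : ℂ) : ℂ := (Real.exp (2 * φ z) : ℂ) * starRingEnd ℂ (dbar b z)

def testSub (ω φ : ℂ → ℝ) : Submodule ℂ (Lp ℂ 2 (muW ω)) where
  carrier := {f | ∃ b : ℂ → ℂ, IsTest b ∧ (f : ℂ → ℂ) =ᵐ[muW ω] sFun φ b}
  zero_mem' := by
    refine ⟨fun _ => 0, ⟨contDiff_const, HasCompactSupport.zero, by simp [tsupport]⟩, ?_⟩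
    filter_upwards [Lp.coeFn_zero ℂ 2 (muW ω)] with z hz
    rw [hz]; simp [sFun, dbar]
  add_mem' := by
    rintro f g ⟨a, ha, hfa⟩ ⟨b, hb, hgb⟩
    refine ⟨fun z => a z + b z, ⟨ha.1.add hb.1, ha.2.1.add hb.2.1,
      (tsupport_add a b).trans (union_subset ha.2.2 hb.2.2)⟩, ?_⟩
    filter_upwards [Lp.coeFn_add f g, hfa, hgb] with z h1 h2 h3
    rw [h1, Pi.add_apply, h2, h3, sFun, sFun, sFun, dbar_add' (ha.1.differentiable (by norm_num) z)
      (hb.1.differentiable (by norm_num) z)]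
    simp; ring
  smul_mem' := by
    rintro c f ⟨a, ha, hfa⟩
    refine ⟨fun z => starRingEnd ℂ c * a z, ⟨contDiff_const.mul ha.1, ha.2.1.mul_left,
      (tsupport_mul_subset_right).trans ha.2.2⟩, ?_⟩
    filter_upwards [Lp.coeFn_smul c f, hfa] with z h1 h2
    rw [h1, Pi.smul_apply, h2, sFun, sFun, dbar_const_mul' _ (ha.1.differentiable (by norm_num) z)]
    simp; ring

section
variable {ω φ : ℂ → ℝ} {τ : ℝ → ℝ} (hW : IsClassW ω φ τ)
include hW

lemma csupp_sFun {b : ℂ → ℂ} (hb : IsTest b) : CSupp (sFun φ b) (tsupport b) := by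
  constructor
  · have h2 := hW.smooth.continuousOn
    have h3 := (dbar_continuous (hb.1.of_le (by norm_num))).continuousOn (s := unitDisc)
    have h4 : ContinuousOn (fun z => starRingEnd ℂ (dbar b z)) unitDisc :=
      Complex.continuous_conj.comp_continuousOn h3
    have h5 : ContinuousOn (fun z => (Real.exp (2 * φ z) : ℂ)) unitDisc :=
      Complex.continuous_ofReal.comp_continuousOn (by fun_prop)
    exact h5.mul h4
  · intro z hz
    simp [sFun, dbar_zero_of_notMem hz]

lemma memLp_sFun {b : ℂ → ℂ} (hb : IsTest b) : MemLp (sFun φ b) 2 (muW ω) :=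
  memLp_csupp hW (csupp_sFun hW hb) hb.2.1 hb.2.2

lemma inner_sFun {b : ℂ → ℂ} (hb : IsTest b) {s w : Lp ℂ 2 (muW ω)}
    (hs : (s : ℂ → ℂ) =ᵐ[muW ω] sFun φ b) {F : ℂ → ℂ} (hw : (w : ℂ → ℂ) =ᵐ[muW ω] F) :
    inner ℂ s w = (Real.pi⁻¹ : ℂ) * ∫ z, dbar b z * F z := by
  rw [L2.inner_def]
  have e1 : ∫ z, inner ℂ (s z) (w z) ∂(muW ω) =
      ∫ z, (Real.exp (2 * φ z) : ℂ) * (dbar b z * F z) ∂(muW ω) := by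
    apply integral_congr_ae
    filter_upwards [hs, hw] with z h1 h2
    rw [h1, h2, RCLike.inner_apply, sFun, map_mul, Complex.conj_ofReal, Complex.conj_conj]
    ring
  rw [e1, integral_muW hW]
  have e2 : ∫ z in unitDisc, ω z • ((Real.exp (2 * φ z) : ℂ) * (dbar b z * F z)) =
      ∫ z in unitDisc, dbar b z * F z := by
    apply setIntegral_congr_fun isOpen_unitDisc.measurableSet
    intro z hz
    simp only
    rw [hW.omega_eq z hz, Complex.real_smul, ← mul_assoc, ← Complex.ofReal_mul, ← Real.exp_add]
    simp
  rw [e2, setIntegral_eq_integral_of_forall_compl_eq_zero]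
  · simp
  · intro z hz
    rw [dbar_zero_of_notMem (fun h => hz (hb.2.2 h)), zero_mul]

end

lemma poly_bdd (p : Polynomial ℂ) : ∃ M : ℝ, ∀ z ∈ unitDisc, ‖p.eval z‖ ≤ M := by
  obtain ⟨M, hM⟩ := (isCompact_closedBall (0:ℂ) 1).exists_bound_of_continuousOn
    (p.continuous.continuousOn)
  exact ⟨M, fun z hz => hM z (Metric.ball_subset_closedBall hz)⟩

section
variable {ω φ : ℂ → ℝ} {τ : ℝ → ℝ} (hW : IsClassW ω φ τ)
include hW

lemma poly_memLp (p : Polynomial ℂ) : MemLp (fun z => p.eval z) 2 (muW ω) := by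
  obtain ⟨M, hM⟩ := poly_bdd p
  exact memLp_bdd hW p.continuous.continuousOn M hM

def polyLp : Polynomial ℂ →ₗ[ℂ] Lp ℂ 2 (muW ω) where
  toFun p := (poly_memLp hW p).toLp
  map_add' p q := by
    rw [← MemLp.toLp_add]
    congr 1; funext z; simp
  map_smul' c p := by
    rw [RingHom.id_apply, ← MemLp.toLp_const_smul]
    congr 1; funext z; simp

lemma polyLp_ae (p : Polynomial ℂ) : (polyLp hW p : ℂ → ℂ) =ᵐ[muW ω] fun z => p.eval z :=
  MemLp.coeFn_toLp (poly_memLp hW p)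

lemma polyLp_mem (p : Polynomial ℂ) : polyLp hW p ∈ bergmanSubmodule ω :=
  ⟨fun z => p.eval z, p.differentiable.differentiableOn, polyLp_ae hW p⟩

def polyH : Polynomial ℂ →ₗ[ℂ] bergmanH ω :=
  (polyLp hW).codRestrict (bergmanH ω)
    (fun p => Submodule.le_topologicalClosure _ (polyLp_mem hW p))

lemma norm_polyH (p : Polynomial ℂ) : ‖polyH hW p‖ = ‖polyLp hW p‖ := rfl

lemma berg_perp_test {f s : Lp ℂ 2 (muW ω)} (hf : f ∈ bergmanSubmodule ω) (hs : s ∈ testSub ω φ) :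
    inner ℂ s f = 0 := by
  obtain ⟨F, hF, hfF⟩ := hf
  obtain ⟨b, hb, hsb⟩ := hs
  rw [inner_sFun hW hb hsb hfF]
  have h1 : ContDiffOn ℝ 1 F unitDisc := by
    intro z hz
    have : ContDiffAt ℂ 1 F z := (hF.contDiffOn isOpen_unitDisc).contDiffAt (isOpen_unitDisc.mem_nhds hz)
    exact (this.restrict_scalars ℝ).contDiffWithinAt
  have h2 := ibp_dbar h1 (hb.1.of_le (by norm_num)) hb.2.1 hb.2.2
  have h3 : ∫ z, dbar F z * b z = 0 := by
    rw [← integral_zero ℂ ℂ (μ := (volume : Measure ℂ))]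
    refine integral_congr_ae (Eventually.of_forall fun z => ?_)
    simp only
    by_cases hz : z ∈ unitDisc
    · rw [dbar_hol (hF.differentiableAt (isOpen_unitDisc.mem_nhds hz)), zero_mul]
    · rw [image_eq_zero_of_notMem_tsupport (fun h => hz (hb.2.2 h)), mul_zero]
  simp_rw [mul_comm (dbar b _)]
  rw [h2, h3]; simp

lemma complete_Lp {x : Lp ℂ 2 (muW ω)} (h1 : ∀ s ∈ testSub ω φ, inner ℂ s x = 0)
    (h2 : ∀ p, inner ℂ (polyLp hW p) x = 0) : x = 0 := by
  have := muW_finite hW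
  set y : ℂ → ℂ := unitDisc.indicator x with hy
  have hxy : (x : ℂ → ℂ) =ᵐ[muW ω] y := by
    filter_upwards [mem_unitDisc_ae hW] with z hz
    rw [hy, indicator_of_mem hz]
  have hxi : Integrable x (muW ω) := (Lp.memLp x).integrable (by norm_num)
  have hyi : Integrable y (muW ω) := hxi.congr hxy
  have hy0 : ∀ z, z ∉ unitDisc → y z = 0 := fun z hz => by rw [hy, indicator_of_notMem hz]
  have hωy : IntegrableOn (fun z => ω z • y z) unitDisc := (integrable_muW hW y).1 hyi
  have hWω : ∀ z ∈ unitDisc, Real.exp (-(2 * φ ((Real.sqrt (Complex.normSq z) : ℝ) : ℂ))) = ω z := by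
    intro z hz
    rw [hW.omega_eq z hz]
    have hn : ‖((Real.sqrt (Complex.normSq z) : ℝ) : ℂ)‖ = ‖z‖ := by
      rw [Complex.normSq_eq_norm_sq, Real.sqrt_sq (norm_nonneg z)]; simp
    rw [hW.radial _ (by rw [mem_unitDisc, hn]; exact mem_unitDisc.1 hz) z hz hn]
  have hz : ∀ᵐ z, y z = 0 := by
    refine completeness (W := fun s => Real.exp (-(2 * φ ((Real.sqrt s : ℝ) : ℂ)))) ?_ ?_ hy0 ?_ ?_ ?_ ?_
    · intro b b1 b2 b3
      have hb : IsTest b := ⟨b1, b2, b3⟩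
      have := h1 ((memLp_sFun hW hb).toLp) ⟨b, hb, MemLp.coeFn_toLp _⟩
      rw [inner_sFun hW hb (MemLp.coeFn_toLp _) hxy] at this
      simpa [Real.pi_ne_zero] using this
    · intro r hr
      have hsub : Metric.closedBall (0:ℂ) r ⊆ unitDisc := Metric.closedBall_subset_ball hr
      have hcont : ContinuousOn (fun z => ((Real.exp (2 * φ z) : ℝ) : ℂ)) (Metric.closedBall (0:ℂ) r) := by
        have h := hW.smooth.continuousOn.mono hsub
        exact Complex.continuous_ofReal.comp_continuousOn (by fun_prop)
      have := (hωy.mono_set hsub).continuousOn_mul hcont (isCompact_closedBall _ _)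
      refine this.congr_fun ?_ measurableSet_closedBall
      intro z hz
      simp only
      rw [hW.omega_eq z (hsub hz), Complex.real_smul, ← mul_assoc, ← Complex.ofReal_mul, ← Real.exp_add]
      simp
    · intro s _; exact Real.exp_pos _
    · have hφ : ContDiffOn ℝ 1 (fun s : ℝ => φ ((Real.sqrt s : ℝ) : ℂ)) (Ioo 0 1) := by
        refine (hW.smooth.of_le (by norm_num)).comp (t := unitDisc) (g := φ)
          (f := fun s : ℝ => ((Real.sqrt s : ℝ) : ℂ)) ?_ ?_
        · intro s hs
          have := (Real.contDiffAt_sqrt (n := 1) hs.1.ne')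
          exact (Complex.ofRealCLM.contDiff.contDiffAt.comp s this).contDiffWithinAt
        · intro s hs
          rw [mem_unitDisc]
          simp only [Complex.norm_real, Real.norm_eq_abs, abs_of_nonneg (Real.sqrt_nonneg s)]
          rw [Real.sqrt_lt' (by norm_num)]
          linarith [hs.2]
      exact (contDiffOn_const.mul hφ).neg.exp
    · refine (integrableOn_iff_integrable_of_support_subset (s := unitDisc) (fun z hz => ?_)).1 ?_
      · by_contra hcon
        apply hz
        rw [hy0 z hcon, mul_zero]
      · refine hωy.congr_fun ?_ isOpen_unitDisc.measurableSet
        intro z hz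
        simp only
        rw [hWω z hz, Complex.real_smul]
    · intro m
      have := h2 (Polynomial.X ^ m)
      rw [L2.inner_def] at this
      have e1 : ∫ z, inner ℂ (polyLp hW (Polynomial.X ^ m) z) (x z) ∂(muW ω) =
          ∫ z, starRingEnd ℂ z ^ m * y z ∂(muW ω) := by
        apply integral_congr_ae
        filter_upwards [polyLp_ae hW (Polynomial.X ^ m), hxy] with z h1 h2
        rw [h1, h2, RCLike.inner_apply]
        simp; ring
      rw [e1, integral_muW hW, smul_eq_zero] at this
      have h3 := this.resolve_left (inv_ne_zero Real.pi_ne_zero)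
      rw [← setIntegral_eq_integral_of_forall_compl_eq_zero (s := unitDisc), ← h3]
      · apply setIntegral_congr_fun isOpen_unitDisc.measurableSet
        intro z hz
        simp only
        rw [hWω z hz, Complex.real_smul]; ring
      · intro z hz; rw [hy0 z hz, mul_zero]
  rw [Lp.eq_zero_iff_ae_eq_zero]
  have hz2 : ∀ᵐ z ∂(muW ω), y z = 0 := (ae_muW_iff hW).2 (ae_restrict_of_ae hz)
  filter_upwards [hxy, hz2] with z h1 h2
  rw [h1, h2]; rfl

lemma perp_closure {f s : Lp ℂ 2 (muW ω)} (hf : f ∈ bergmanH ω) (hs : s ∈ testSub ω φ) :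
    inner ℂ s f = 0 := by
  have h1 : bergmanSubmodule ω ≤ (testSub ω φ)ᗮ := fun f hf => by
    rw [Submodule.mem_orthogonal]
    exact fun s hs => berg_perp_test hW hf hs
  have h2 := Submodule.topologicalClosure_minimal _ h1 (Submodule.isClosed_orthogonal _)
  exact (Submodule.mem_orthogonal _ _).1 (h2 hf) s hs

lemma bergmanPerp_le {x : Lp ℂ 2 (muW ω)} (hx : x ∈ (bergmanH ω)ᗮ) :
    x ∈ (testSub ω φ).topologicalClosure := by
  set S := (testSub ω φ).topologicalClosure with hS
  have hSc : IsClosed (S : Set (Lp ℂ 2 (muW ω))) := Submodule.isClosed_topologicalClosure _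
  have : CompleteSpace S := hSc.completeSpace_coe
  have hSle : S ≤ (bergmanH ω)ᗮ := by
    refine Submodule.topologicalClosure_minimal _ ?_ (Submodule.isClosed_orthogonal _)
    intro s hs
    rw [Submodule.mem_orthogonal']
    exact fun f hf => perp_closure hW hf hs
  obtain ⟨s, hs, w, hw, hxw⟩ := Submodule.exists_add_mem_mem_orthogonal (K := S) x
  have hw0 : w = 0 := by
    apply complete_Lp hW
    · intro t ht
      exact (Submodule.mem_orthogonal _ _).1 hw t (Submodule.le_topologicalClosure _ ht)
    · intro p
      have : w ∈ (bergmanH ω)ᗮ := by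
        have e : w = x - s := by rw [hxw]; abel
        rw [e]; exact Submodule.sub_mem _ hx (hSle hs)
      exact (Submodule.mem_orthogonal _ _).1 this _ (polyH hW p).2
  rw [hxw, hw0, add_zero]; exact hs

lemma poly_dense : DenseRange (polyH hW) := by
  set V := (LinearMap.range (polyLp hW)).topologicalClosure with hV
  have hVc : IsClosed (V : Set (Lp ℂ 2 (muW ω))) := Submodule.isClosed_topologicalClosure _
  have : CompleteSpace V := hVc.completeSpace_coe
  have hVle : V ≤ bergmanH ω := by
    refine Submodule.topologicalClosure_minimal _ ?_ (Submodule.isClosed_topologicalClosure _)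
    rintro _ ⟨p, rfl⟩
    exact (polyH hW p).2
  have hle : bergmanH ω ≤ V := by
    intro x hx
    obtain ⟨s, hs, w, hw, hxw⟩ := Submodule.exists_add_mem_mem_orthogonal (K := V) x
    have hw0 : w = 0 := by
      apply complete_Lp hW
      · intro t ht
        have : w ∈ bergmanH ω := by
          have e : w = x - s := by rw [hxw]; abel
          rw [e]; exact Submodule.sub_mem _ hx (hVle hs)
        exact perp_closure hW this ht
      · intro p
        exact (Submodule.mem_orthogonal _ _).1 hw _ (Submodule.le_topologicalClosure _ ⟨p, rfl⟩)
    rw [hxw, hw0, add_zero]; exact hs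
  intro x
  have hx : (x : Lp ℂ 2 (muW ω)) ∈ closure (LinearMap.range (polyLp hW) : Set (Lp ℂ 2 (muW ω))) := hle x.2
  rw [Metric.mem_closure_iff] at hx ⊢
  intro ε hε
  obtain ⟨_, ⟨p, rfl⟩, hp⟩ := hx ε hε
  exact ⟨polyH hW p, ⟨p, rfl⟩, hp⟩

end

lemma normSq_Lp {μ : Measure ℂ} (f : Lp ℂ 2 μ) {F : ℂ → ℂ} (hF : (f : ℂ → ℂ) =ᵐ[μ] F) :
    ‖f‖ ^ 2 = ∫ z, ‖F z‖ ^ 2 ∂μ := by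
  have h1 : (inner ℂ f f : ℂ) = ((∫ z, ‖F z‖ ^ 2 ∂μ : ℝ) : ℂ) := by
    rw [L2.inner_def, ← integral_complex_ofReal]
    apply integral_congr_ae
    filter_upwards [hF] with z hz
    rw [hz, inner_self_eq_norm_sq_to_K]; simp
  rw [inner_self_eq_norm_sq_to_K] at h1
  apply Complex.ofReal_injective
  rw [← h1]; simp

section
variable {ω φ : ℂ → ℝ} {τ : ℝ → ℝ} (hW : IsClassW ω φ τ)
include hW

/-- the function `e^{2φ} √Δφ conj b` -/
lemma csupp_u {b : ℂ → ℂ} (hb : IsTest b) :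
    CSupp (fun z => ((Real.exp (2 * φ z) * Real.sqrt (laplacian φ z) : ℝ) : ℂ) * starRingEnd ℂ (b z))
      (tsupport b) := by
  constructor
  · have h2 := hW.smooth.continuousOn
    have h3 := laplacian_continuousOn hW.smooth
    have h4 : ContinuousOn (fun z => starRingEnd ℂ (b z)) unitDisc :=
      (Complex.continuous_conj.comp hb.1.continuous).continuousOn
    have h5 : ContinuousOn (fun z => ((Real.exp (2 * φ z) * Real.sqrt (laplacian φ z) : ℝ) : ℂ)) unitDisc :=
      Complex.continuous_ofReal.comp_continuousOn (by fun_prop)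
    exact h5.mul h4
  · intro z hz
    rw [image_eq_zero_of_notMem_tsupport hz]; simp

lemma norm_u_le {b : ℂ → ℂ} (hb : IsTest b) {s u : Lp ℂ 2 (muW ω)}
    (hs : (s : ℂ → ℂ) =ᵐ[muW ω] sFun φ b)
    (hu : (u : ℂ → ℂ) =ᵐ[muW ω] fun z =>
      ((Real.exp (2 * φ z) * Real.sqrt (laplacian φ z) : ℝ) : ℂ) * starRingEnd ℂ (b z)) :
    ‖u‖ ≤ Real.sqrt 2 * ‖s‖ := by
  have h1 : ‖u‖ ^ 2 = Real.pi⁻¹ * ∫ z, laplacian φ z * ‖b z‖ ^ 2 * Real.exp (2 * φ z) := by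
    rw [normSq_Lp u hu, integral_muW hW, smul_eq_mul]
    congr 1
    rw [← setIntegral_eq_integral_of_forall_compl_eq_zero (s := unitDisc)
      (f := fun z => laplacian φ z * ‖b z‖ ^ 2 * Real.exp (2 * φ z))]
    · apply setIntegral_congr_fun isOpen_unitDisc.measurableSet
      intro z hz
      simp only
      rw [hW.omega_eq z hz, smul_eq_mul, norm_mul, RCLike.norm_conj, Complex.norm_real, Real.norm_eq_abs,
        abs_of_nonneg (by positivity), mul_pow, mul_pow, Real.sq_sqrt (hW.lap_pos z hz).le, Real.exp_neg]
      field_simp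
    · intro z hz
      rw [image_eq_zero_of_notMem_tsupport (fun h => hz (hb.2.2 h))]; simp
  have h2 : ‖s‖ ^ 2 = Real.pi⁻¹ * ∫ z, ‖dbar b z‖ ^ 2 * Real.exp (2 * φ z) := by
    rw [normSq_Lp s hs, integral_muW hW, smul_eq_mul]
    congr 1
    rw [← setIntegral_eq_integral_of_forall_compl_eq_zero (s := unitDisc)
      (f := fun z => ‖dbar b z‖ ^ 2 * Real.exp (2 * φ z))]
    · apply setIntegral_congr_fun isOpen_unitDisc.measurableSet
      intro z hz
      simp only [sFun]
      rw [hW.omega_eq z hz, smul_eq_mul, norm_mul, RCLike.norm_conj, Complex.norm_real, Real.norm_eq_abs,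
        abs_of_nonneg (by positivity), mul_pow, Real.exp_neg]
      field_simp
    · intro z hz
      rw [dbar_zero_of_notMem (fun h => hz (hb.2.2 h))]; simp
  have h3 := hormander_basic hW.smooth hb.1 hb.2.1 hb.2.2
  have h4 : ‖u‖ ^ 2 ≤ 2 * ‖s‖ ^ 2 := by
    rw [h1, h2]
    have := mul_le_mul_of_nonneg_left h3 (inv_nonneg.2 Real.pi_pos.le)
    linarith
  apply le_of_sq_le_sq _ (by positivity)
  rw [mul_pow, Real.sq_sqrt (by norm_num)]
  exact h4

lemma hankel_bound {g g₁ g₂ : ℂ → ℂ} (hgg : ∀ z ∈ unitDisc, g z = g₁ z + g₂ z)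
    (hg₂ : ContDiffOn ℝ 1 g₂ unitDisc) (p : Polynomial ℂ) {gp G1 H : Lp ℂ 2 (muW ω)}
    (hgp : (gp : ℂ → ℂ) =ᵐ[muW ω] fun z => g z * p.eval z)
    (hG1 : (G1 : ℂ → ℂ) =ᵐ[muW ω] fun z => g₁ z * p.eval z)
    (hH : (H : ℂ → ℂ) =ᵐ[muW ω] fun z => dbar g₂ z / (Real.sqrt (laplacian φ z) : ℂ) * p.eval z) :
    ‖gp - bergmanProj ω gp‖ ≤ ‖G1‖ + Real.sqrt 2 * ‖H‖ := by
  set M := ‖G1‖ + Real.sqrt 2 * ‖H‖ with hM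
  have key : ∀ s ∈ testSub ω φ, ‖inner ℂ s gp‖ ≤ M * ‖s‖ := by
    rintro s ⟨b, hb, hs⟩
    set k := gp - G1 with hk
    have hkae : (k : ℂ → ℂ) =ᵐ[muW ω] fun z => g₂ z * p.eval z := by
      filter_upwards [Lp.coeFn_sub gp G1, hgp, hG1, mem_unitDisc_ae hW] with z h1 h2 h3 h4
      rw [h1, Pi.sub_apply, h2, h3, hgg z h4]; ring
    set u : Lp ℂ 2 (muW ω) := (memLp_csupp hW (csupp_u hW hb) hb.2.1 hb.2.2).toLp with hu
    have huae := (memLp_csupp hW (csupp_u hW hb) hb.2.1 hb.2.2).coeFn_toLp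
    have e1 : (inner ℂ s gp : ℂ) = inner ℂ s G1 + inner ℂ s k := by
      rw [← inner_add_right, hk]; congr 1; abel
    have e2 : (inner ℂ u H : ℂ) = (Real.pi⁻¹ : ℂ) * ∫ z, dbar g₂ z * p.eval z * b z := by
      rw [L2.inner_def]
      have e3 : ∫ z, inner ℂ (u z) (H z) ∂(muW ω) =
          ∫ z, (Real.exp (2 * φ z) : ℂ) * (dbar g₂ z * p.eval z * b z) ∂(muW ω) := by
        apply integral_congr_ae
        filter_upwards [huae, hH, mem_unitDisc_ae hW] with z h1 h2 h3
        have h4 : (Real.sqrt (laplacian φ z) : ℂ) ≠ 0 := by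
          exact_mod_cast (Real.sqrt_pos.2 (hW.lap_pos z h3)).ne'
        rw [h1, h2, RCLike.inner_apply, map_mul, Complex.conj_ofReal, Complex.conj_conj]
        push_cast
        field_simp
      rw [e3, integral_muW hW, ← setIntegral_eq_integral_of_forall_compl_eq_zero (s := unitDisc)
        (f := fun z => dbar g₂ z * p.eval z * b z)]
      · rw [Complex.real_smul]
        rw [Complex.ofReal_inv]
        congr 1
        apply setIntegral_congr_fun isOpen_unitDisc.measurableSet
        intro z hz
        simp only
        rw [hW.omega_eq z hz, Complex.real_smul, ← mul_assoc, ← Complex.ofReal_mul, ← Real.exp_add]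
        simp
      · intro z hz
        rw [image_eq_zero_of_notMem_tsupport (fun h => hz (hb.2.2 h)), mul_zero]
    have hpC : ContDiff ℝ 1 (fun z : ℂ => p.eval z) := by
      have : ContDiff ℂ 1 (fun z : ℂ => p.eval z) := p.differentiable.contDiff
      exact this.restrict_scalars ℝ
    have e4 : (inner ℂ s k : ℂ) = - inner ℂ u H := by
      rw [inner_sFun hW hb hs hkae, e2]
      have := ibp_dbar (F := fun z => g₂ z * p.eval z) (hg₂.mul hpC.contDiffOn)
        (hb.1.of_le (by norm_num)) hb.2.1 hb.2.2
      simp_rw [mul_comm (dbar b _)]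
      rw [this, mul_neg]
      congr 2
      refine integral_congr_ae (Eventually.of_forall fun z => ?_)
      simp only
      by_cases hz : z ∈ unitDisc
      · rw [dbar_mul_hol ((hg₂.contDiffAt (isOpen_unitDisc.mem_nhds hz)).differentiableAt (by norm_num))
          p.differentiableAt]
      · rw [image_eq_zero_of_notMem_tsupport (fun h => hz (hb.2.2 h)), mul_zero, mul_zero]
    rw [e1, e4]
    calc ‖(inner ℂ s G1 : ℂ) + - inner ℂ u H‖ ≤ ‖(inner ℂ s G1 : ℂ)‖ + ‖(inner ℂ u H : ℂ)‖ := by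
          refine (norm_add_le _ _).trans ?_
          rw [norm_neg]
      _ ≤ ‖s‖ * ‖G1‖ + ‖u‖ * ‖H‖ := add_le_add (norm_inner_le_norm _ _) (norm_inner_le_norm _ _)
      _ ≤ ‖s‖ * ‖G1‖ + Real.sqrt 2 * ‖s‖ * ‖H‖ := by
          gcongr
          exact norm_u_le hW hb hs huae
      _ = M * ‖s‖ := by rw [hM]; ring
  have key2 : ∀ s ∈ (testSub ω φ).topologicalClosure, ‖(inner ℂ s gp : ℂ)‖ ≤ M * ‖s‖ := by
    have hcl : IsClosed {s : Lp ℂ 2 (muW ω) | ‖(inner ℂ s gp : ℂ)‖ ≤ M * ‖s‖} :=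
      isClosed_le (by fun_prop) (by fun_prop)
    intro s hs
    exact closure_minimal (fun t ht => key t ht) hcl hs
  set v := gp - bergmanProj ω gp with hv
  have hvp : v ∈ (bergmanH ω)ᗮ := Submodule.sub_starProjection_mem_orthogonal (K := bergmanH ω) gp
  have h1 := key2 v (bergmanPerp_le hW hvp)
  have h2 : (inner ℂ v gp : ℂ) = inner ℂ v v := by
    have h3 : (inner ℂ v (bergmanProj ω gp) : ℂ) = 0 :=
      (Submodule.mem_orthogonal' _ _).1 hvp _ (bergmanProjA ω gp).2
    conv_rhs => rw [hv]
    rw [← hv, inner_sub_right, h3, sub_zero]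
  rw [h2, inner_self_eq_norm_sq_to_K] at h1
  simp at h1
  by_contra hcon
  push Not at hcon
  have hM0 : 0 ≤ M := by positivity
  nlinarith
end

lemma circle_enorm {f : ℂ → ℂ} {w : ℂ} {r ρ : ℝ} (hρ : 0 < ρ) (hρr : ρ < r)
    (hf : DifferentiableOn ℂ f (Metric.ball w r)) :
    ENNReal.ofReal (2 * Real.pi * ‖f w‖) ≤ ∫⁻ θ in Ioo (-Real.pi) Real.pi, ‖f (circleMap w ρ θ)‖ₑ := by
  have h1 : DiffContOnCl ℂ f (Metric.ball w |ρ|) := by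
    rw [abs_of_pos hρ]
    apply DifferentiableOn.diffContOnCl
    rw [closure_ball _ hρ.ne']
    exact hf.mono (Metric.closedBall_subset_ball hρr)
  have h2 := h1.circleAverage
  rw [Real.circleAverage_def] at h2
  have h3 : ∫ θ in (0:ℝ)..(2 * Real.pi), f (circleMap w ρ θ) =
      ∫ θ in (-Real.pi)..Real.pi, f (circleMap w ρ θ) := by
    have hp : Function.Periodic (fun θ => f (circleMap w ρ θ)) (2 * Real.pi) := fun θ => by
      simp only; rw [periodic_circleMap w ρ θ]
    have := hp.intervalIntegral_add_eq 0 (-Real.pi)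
    rw [zero_add, show -Real.pi + 2 * Real.pi = Real.pi by ring] at this
    exact this
  have h4 : ∫ θ in (-Real.pi)..Real.pi, f (circleMap w ρ θ) = (2 * Real.pi : ℝ) • f w := by
    rw [← h2, h3, smul_smul, mul_inv_cancel₀ (by positivity), one_smul]
  rw [intervalIntegral.integral_of_le (by linarith [Real.pi_pos]), integral_Ioc_eq_integral_Ioo] at h4
  calc ENNReal.ofReal (2 * Real.pi * ‖f w‖) = ‖(2 * Real.pi : ℝ) • f w‖ₑ := by
        rw [← ofReal_norm, norm_smul, Real.norm_of_nonneg (by positivity)]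
    _ ≤ _ := by
        rw [← h4]
        exact enorm_integral_le_lintegral_enorm _

lemma submean_vol {f : ℂ → ℂ} {w : ℂ} {r : ℝ} (hr : 0 < r)
    (hf : DifferentiableOn ℂ f (Metric.ball w r)) :
    ENNReal.ofReal (Real.pi * (r ^ 2 * ‖f w‖)) ≤ ∫⁻ z in Metric.ball w r, ‖f z‖ₑ := by
  classical
  set G : ℂ → ℝ≥0∞ := (Metric.ball w r).indicator (fun z => ‖f z‖ₑ) with hG
  have hGm : Measurable G := by
    have : Measurable ((Metric.ball w r).piecewise f 0) :=
      hf.continuousOn.measurable_piecewise continuousOn_const measurableSet_ball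
    have e : G = fun z => ‖(Metric.ball w r).piecewise f 0 z‖ₑ := by
      funext z
      by_cases hz : z ∈ Metric.ball w r
      · rw [hG, indicator_of_mem hz, piecewise_eq_of_mem _ _ _ hz]
      · rw [hG, indicator_of_notMem hz, piecewise_eq_of_notMem _ _ _ hz]; simp
    rw [e]; exact this.enorm
  rw [← lintegral_indicator measurableSet_ball, ← lintegral_add_left_eq_self _ w,
    ← Complex.lintegral_comp_polarCoord_symm, polarCoord_target, Measure.volume_eq_prod,
    ← Measure.prod_restrict, lintegral_prod]
  swap
  · apply Measurable.aemeasurable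
    have hm : Measurable (fun p : ℝ × ℝ => Complex.polarCoord.symm p) := by
      have : (fun p : ℝ × ℝ => Complex.polarCoord.symm p) = fun p : ℝ × ℝ =>
        (p.1 : ℂ) * (Real.cos p.2 + Real.sin p.2 * Complex.I) := by
        funext p; exact Complex.polarCoord_symm_apply p
      rw [this]; fun_prop
    exact (measurable_fst.ennreal_ofReal).smul (hGm.comp (measurable_const.add hm))
  have hin : ∀ ρ ∈ Ioi (0:ℝ), (Ioo 0 r).indicator (fun ρ => ENNReal.ofReal (2 * Real.pi * ‖f w‖ * ρ)) ρ ≤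
      ∫⁻ θ in Ioo (-Real.pi) Real.pi, ENNReal.ofReal ρ • G (w + Complex.polarCoord.symm (ρ, θ)) := by
    intro ρ hρ
    by_cases hρr : ρ ∈ Ioo 0 r
    · rw [indicator_of_mem hρr]
      simp_rw [smul_eq_mul]
      rw [lintegral_const_mul' _ _ ENNReal.ofReal_ne_top, mul_comm _ ρ,
        ENNReal.ofReal_mul (le_of_lt hρ)]
      gcongr
      refine (circle_enorm hρr.1 hρr.2 hf).trans (le_of_eq ?_)
      refine lintegral_congr fun θ => ?_
      have e : w + Complex.polarCoord.symm (ρ, θ) = circleMap w ρ θ := by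
        rw [Complex.polarCoord_symm_apply, circleMap, Complex.exp_mul_I]
        push_cast; rfl
      rw [e, hG, indicator_of_mem]
      rw [Metric.mem_ball, dist_eq_norm, ← e]
      simp only [add_sub_cancel_left]
      rw [Complex.norm_polarCoord_symm, abs_of_pos hρr.1]
      exact hρr.2
    · rw [indicator_of_notMem hρr]; exact zero_le
  refine le_trans ?_ (setLIntegral_mono' measurableSet_Ioi hin)
  rw [setLIntegral_indicator measurableSet_Ioo, inter_eq_left.2 (fun x hx => hx.1)]
  rw [← ofReal_integral_eq_lintegral_ofReal]
  · apply le_of_eq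
    congr 1
    rw [← integral_Ioc_eq_integral_Ioo, ← intervalIntegral.integral_of_le hr.le,
      intervalIntegral.integral_const_mul, integral_id]
    ring
  · exact (Continuous.integrableOn_Icc (by fun_prop)).mono_set Ioo_subset_Icc_self
  · filter_upwards [ae_restrict_mem measurableSet_Ioo] with x hx
    have := hx.1.le
    simp only [Pi.zero_apply]; positivity

lemma submean {f : ℂ → ℂ} {w : ℂ} {r : ℝ} (hr : 0 < r)
    (hf : DifferentiableOn ℂ f (Metric.ball w r)) :
    ENNReal.ofReal (r ^ 2 * ‖f w‖ ^ 2) ≤ ∫⁻ z in Metric.ball w r, ENNReal.ofReal (‖f z‖ ^ 2) ∂dA := by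
  have h := submean_vol hr (hf.pow 2)
  have e : ∫⁻ z in Metric.ball w r, ENNReal.ofReal (‖f z‖ ^ 2) ∂dA =
      (ENNReal.ofReal Real.pi)⁻¹ * ∫⁻ z in Metric.ball w r, ‖(f ^ 2) z‖ₑ := by
    rw [dA, Measure.restrict_smul, lintegral_smul_measure, smul_eq_mul]
    congr 1
    refine lintegral_congr fun z => ?_
    rw [← ofReal_norm]; simp
  rw [e]
  have h1 : ENNReal.ofReal (r ^ 2 * ‖f w‖ ^ 2) =
      (ENNReal.ofReal Real.pi)⁻¹ * ENNReal.ofReal (Real.pi * (r ^ 2 * ‖(f ^ 2) w‖)) := by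
    rw [ENNReal.ofReal_mul Real.pi_pos.le, ← mul_assoc, ENNReal.inv_mul_cancel (by simp [Real.pi_pos]) (by simp),
      one_mul]
    simp
  rw [h1]
  gcongr

lemma radial_tangent {ω φ : ℂ → ℝ} {τ : ℝ → ℝ} (hW : IsClassW ω φ τ) {w : ℂ} (hw : w ∈ unitDisc) :
    fderiv ℝ φ w (Complex.I * w) = 0 := by
  have hd : DifferentiableAt ℝ φ w :=
    (hW.smooth.contDiffAt (isOpen_unitDisc.mem_nhds hw)).differentiableAt (by norm_num)
  have hc : HasDerivAt (fun s : ℝ => w * Complex.exp (Complex.I * s)) (Complex.I * w) 0 := by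
    have h1 : HasDerivAt (fun s : ℝ => Complex.exp (Complex.I * (s : ℂ)))
        (Complex.exp (Complex.I * ((0 : ℝ) : ℂ)) * (Complex.I * 1)) (0 : ℝ) :=
      HasDerivAt.comp_ofReal (e := fun s : ℂ => Complex.exp (Complex.I * s))
        (((hasDerivAt_id _).const_mul Complex.I).cexp)
    have h2 := h1.const_mul w
    refine h2.congr_deriv ?_
    simp; ring
  have h0 : HasFDerivAt φ (fderiv ℝ φ w) ((fun s : ℝ => w * Complex.exp (Complex.I * s)) 0) := by
    simpa using hd.hasFDerivAt
  have h1 := h0.comp_hasDerivAt (0:ℝ) hc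
  have h2 : (φ ∘ fun s : ℝ => w * Complex.exp (Complex.I * s)) = fun _ => φ w := by
    funext s
    have hn : ‖w * Complex.exp (Complex.I * s)‖ = ‖w‖ := by
      rw [norm_mul, Complex.norm_exp]; simp
    exact hW.radial _ (by rw [mem_unitDisc, hn]; exact mem_unitDisc.1 hw) _ hw hn
  rw [h2] at h1
  exact h1.unique (hasDerivAt_const _ _)

lemma radial_yy {ω φ : ℂ → ℝ} {τ : ℝ → ℝ} (hW : IsClassW ω φ τ) {r : ℝ} (hr : (r : ℂ) ∈ unitDisc) :
    r * fderiv ℝ (fun w => fderiv ℝ φ w Complex.I) r Complex.I = fderiv ℝ φ r 1 := by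
  have hcd := hW.smooth.contDiffAt (isOpen_unitDisc.mem_nhds hr)
  have hG : DifferentiableAt ℝ (fderiv ℝ φ) (r:ℂ) :=
    (hcd.fderiv_right (m := 1) (by norm_num)).differentiableAt (by norm_num)
  have h1 : HasFDerivAt (fun w => fderiv ℝ φ w Complex.I)
      ((fderiv ℝ (fderiv ℝ φ) (r:ℂ)).flip Complex.I) (r:ℂ) := by
    have := hG.hasFDerivAt.clm_apply (hasFDerivAt_const Complex.I (r:ℂ))
    refine this.congr_fderiv ?_
    simp
  have hlin : HasFDerivAt (fun w : ℂ => Complex.I * w)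
      ((ContinuousLinearMap.mul ℝ ℂ) Complex.I) (r:ℂ) :=
    ((ContinuousLinearMap.mul ℝ ℂ) Complex.I).hasFDerivAt
  have h2 := hG.hasFDerivAt.clm_apply hlin
  have h3 : HasFDerivAt (fun w => fderiv ℝ φ w (Complex.I * w)) (0 : ℂ →L[ℝ] ℝ) (r:ℂ) := by
    apply (hasFDerivAt_const (0:ℝ) (r:ℂ)).congr_of_eventuallyEq
    filter_upwards [isOpen_unitDisc.mem_nhds hr] with w hw
    exact radial_tangent hW hw
  have h4 := h2.unique h3
  have h5 := congrArg (fun L : ℂ →L[ℝ] ℝ => L Complex.I) h4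
  simp at h5
  rw [h1.fderiv]
  have e1 : Complex.I * (r:ℂ) = r • Complex.I := by simp [mul_comm]
  rw [e1, map_smul] at h5
  simp at h5 ⊢
  linarith

lemma hasDerivAt_Phi {ω φ : ℂ → ℝ} {τ : ℝ → ℝ} (hW : IsClassW ω φ τ) {t : ℝ} (ht : t < 0) :
    HasDerivAt (fun t : ℝ => φ ((Real.exp t : ℝ) : ℂ))
      (Real.exp t * fderiv ℝ φ ((Real.exp t : ℝ) : ℂ) 1) t ∧
    HasDerivAt (fun t : ℝ => Real.exp t * fderiv ℝ φ ((Real.exp t : ℝ) : ℂ) 1)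
      (Real.exp t ^ 2 * laplacian φ ((Real.exp t : ℝ) : ℂ)) t := by
  have hr : ((Real.exp t : ℝ) : ℂ) ∈ unitDisc := by
    rw [mem_unitDisc, Complex.norm_real, Real.norm_of_nonneg (Real.exp_pos t).le]
    simpa using ht
  have hcd := hW.smooth.contDiffAt (isOpen_unitDisc.mem_nhds hr)
  have hcu : HasDerivAt (fun s : ℝ => ((Real.exp s : ℝ) : ℂ)) ((Real.exp t : ℝ) : ℂ) t :=
    (Real.hasDerivAt_exp t).ofReal_comp
  have e1 : ((Real.exp t : ℝ) : ℂ) = Real.exp t • (1:ℂ) := by simp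
  constructor
  · have h := (hcd.differentiableAt (by norm_num)).hasFDerivAt.comp_hasDerivAt t hcu
    refine h.congr_deriv ?_
    conv_lhs => enter [2]; rw [e1]
    rw [map_smul]; simp
  · have hG : DifferentiableAt ℝ (fderiv ℝ φ) ((Real.exp t : ℝ) : ℂ) :=
      (hcd.fderiv_right (m := 1) (by norm_num)).differentiableAt (by norm_num)
    have h1 : DifferentiableAt ℝ (fun w => fderiv ℝ φ w 1) ((Real.exp t : ℝ) : ℂ) :=
      hG.clm_apply (differentiableAt_const _)
    have h2 := (Real.hasDerivAt_exp t).mul (h1.hasFDerivAt.comp_hasDerivAt t hcu)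
    have e2 : fderiv ℝ (fun w => fderiv ℝ φ w 1) ((Real.exp t : ℝ) : ℂ) ((Real.exp t : ℝ) : ℂ)
       = Real.exp t * fderiv ℝ (fun w => fderiv ℝ φ w 1) ((Real.exp t : ℝ) : ℂ) 1 := by
      conv_lhs => enter [2]; rw [e1]
      rw [map_smul]; simp
    rw [e2] at h2
    refine h2.congr_deriv ?_
    unfold laplacian
    have := radial_yy hW hr
    simp only [Function.comp]
    rw [← this]; ring

lemma taylor2 {F F' F'' : ℝ → ℝ} {t₀ t M : ℝ} (h1 : ∀ s ∈ uIcc t₀ t, HasDerivAt F (F' s) s)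
    (h2 : ∀ s ∈ uIcc t₀ t, HasDerivAt F' (F'' s) s) (hM : ∀ s ∈ uIcc t₀ t, |F'' s| ≤ M) :
    |F t - (F t₀ + F' t₀ * (t - t₀))| ≤ M * |t - t₀| ^ 2 := by
  have hM0 : 0 ≤ M := (abs_nonneg _).trans (hM t₀ left_mem_uIcc)
  have hF' : ∀ s ∈ uIcc t₀ t, ‖F' s - F' t₀‖ ≤ M * |t - t₀| := by
    intro s hs
    have := (convex_uIcc t₀ t).norm_image_sub_le_of_norm_hasDerivWithin_le
      (fun x hx => (h2 x hx).hasDerivWithinAt) (fun x hx => hM x hx) left_mem_uIcc hs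
    refine this.trans ?_
    gcongr
    rw [Real.norm_eq_abs]
    exact abs_sub_left_of_mem_uIcc hs
  have := (convex_uIcc t₀ t).norm_image_sub_le_of_norm_hasDerivWithin_le
      (f := fun s => F s - F' t₀ * s) (f' := fun s => F' s - F' t₀) (C := M * |t - t₀|)
      (fun x hx => ((h1 x hx).sub (by simpa using (hasDerivAt_id x).const_mul (F' t₀))).hasDerivWithinAt)
      hF' left_mem_uIcc right_mem_uIcc
  rw [Real.norm_eq_abs, Real.norm_eq_abs] at this
  calc _ = |F t - F' t₀ * t - (F t₀ - F' t₀ * t₀)| := by congr 1; ring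
    _ ≤ _ := this.trans (by rw [pow_two]; linarith)

lemma tau_radius {τ : ℝ → ℝ} {c₁ c₂ δ : ℝ} (hL : IsClassL (radialize τ) c₁ c₂)
    (hδ : δ ∈ Set.Ioo 0 (mTau c₁ c₂)) {a : ℂ} (ha : a ∈ unitDisc) :
    0 < δ * radialize τ a ∧ δ * radialize τ a ≤ (1 - ‖a‖) / 4 := by
  obtain ⟨hδ0, hδ1, hδc₁, hδc₂⟩ := mTau_facts hL.c₁_pos hL.c₂_pos hδ
  refine ⟨mul_pos hδ0 (hL.pos a ha), ?_⟩
  have h1 := hL.upper a ha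
  have h2 := mem_unitDisc.1 ha
  nlinarith

lemma ball_two_subset {τ : ℝ → ℝ} {c₁ c₂ δ : ℝ} (hL : IsClassL (radialize τ) c₁ c₂)
    (hδ : δ ∈ Set.Ioo 0 (mTau c₁ c₂)) {a : ℂ} (ha : a ∈ unitDisc) :
    Metric.ball a (2 * (δ * radialize τ a)) ⊆ unitDisc := by
  intro z hz
  have h1 := (tau_radius hL hδ ha).2
  have h2 := mem_unitDisc.1 ha
  rw [Metric.mem_ball, dist_eq_norm] at hz
  have : ‖z‖ ≤ ‖z - a‖ + ‖a‖ := by simpa using norm_add_le (z - a) a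
  rw [mem_unitDisc]; linarith

lemma phi_log_bound {ω φ : ℂ → ℝ} {τ : ℝ → ℝ} {c₁ c₂ δ C : ℝ} (hW : IsClassW ω φ τ)
    (hL : IsClassL (radialize τ) c₁ c₂) (hδ : δ ∈ Set.Ioo 0 (mTau c₁ c₂)) (hC : 1 ≤ C)
    (hcomp : ∀ z ∈ unitDisc, τ ‖z‖ / C ≤ (laplacian φ z) ^ (-(1 / 2 : ℝ)))
    {a : ℂ} (ha : a ∈ unitDisc) (ha2 : 1 / 2 ≤ ‖a‖) :
    ∃ A B : ℝ, ∀ z ∈ Metric.ball a (2 * (δ * radialize τ a)),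
      |φ z - (A + B * Real.log (‖z‖ / ‖a‖))| ≤ 16 * C ^ 2 := by
  obtain ⟨hδ0, hδ1, hδc₁, hδc₂⟩ := mTau_facts hL.c₁_pos hL.c₂_pos hδ
  obtain ⟨hρ0, hρ1⟩ := tau_radius hL hδ ha
  have ha1 := mem_unitDisc.1 ha
  have hτ0 : 0 < τ ‖a‖ := hL.pos a ha
  set F' : ℝ → ℝ := fun t => Real.exp t * fderiv ℝ φ ((Real.exp t : ℝ) : ℂ) 1 with hF'
  refine ⟨φ ((Real.exp (Real.log ‖a‖) : ℝ) : ℂ), F' (Real.log ‖a‖), fun z hz => ?_⟩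
  have hzD := ball_two_subset hL hδ ha hz
  have hz1 := mem_unitDisc.1 hzD
  rw [Metric.mem_ball, dist_eq_norm] at hz
  have hna : 0 < ‖a‖ := by linarith
  have hza : |‖z‖ - ‖a‖| < 2 * (δ * radialize τ a) := (abs_norm_sub_norm_le z a).trans_lt hz
  have hza' := abs_lt.1 hza
  have hnz : 1 / 4 ≤ ‖z‖ := by linarith
  have hnz0 : 0 < ‖z‖ := by linarith
  have hexp : ∀ s ∈ uIcc (Real.log ‖a‖) (Real.log ‖z‖), Real.exp s ∈ uIcc ‖a‖ ‖z‖ := by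
    intro s hs
    have := (Real.exp_monotone.monotoneOn (uIcc (Real.log ‖a‖) (Real.log ‖z‖))).image_uIcc_subset
      (mem_image_of_mem _ hs)
    rwa [Real.exp_log hna, Real.exp_log hnz0] at this
  have hneg : ∀ s ∈ uIcc (Real.log ‖a‖) (Real.log ‖z‖), s < 0 := by
    intro s hs
    have h1 := hexp s hs
    have h2 : Real.exp s < 1 := by
      have := h1.2
      exact this.trans_lt (max_lt ha1 hz1)
    simpa using h2
  have hT := taylor2 (F := fun t : ℝ => φ ((Real.exp t : ℝ) : ℂ)) (F' := F')
    (F'' := fun t => Real.exp t ^ 2 * laplacian φ ((Real.exp t : ℝ) : ℂ))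
    (t₀ := Real.log ‖a‖) (t := Real.log ‖z‖) (M := 4 * C ^ 2 / τ ‖a‖ ^ 2)
    (fun s hs => (hasDerivAt_Phi hW (hneg s hs)).1) (fun s hs => (hasDerivAt_Phi hW (hneg s hs)).2)
    (by
      intro s hs
      have hnr : ‖((Real.exp s : ℝ) : ℂ)‖ = Real.exp s := by
        rw [Complex.norm_real, Real.norm_of_nonneg (Real.exp_pos s).le]
      have hs1 : Real.exp s < 1 := by simpa using hneg s hs
      have hsD : ((Real.exp s : ℝ) : ℂ) ∈ unitDisc := by rw [mem_unitDisc, hnr]; exact hs1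
      have hlp := hW.lap_pos _ hsD
      have hcs := hcomp _ hsD
      rw [hnr] at hcs
      have haD : ((‖a‖ : ℝ) : ℂ) ∈ unitDisc := by
        rw [mem_unitDisc, Complex.norm_real, norm_norm]; exact ha1
      have hlip := hL.lip _ hsD _ haD
      unfold radialize at hlip
      rw [hnr, Complex.norm_real, norm_norm, ← Complex.ofReal_sub, Complex.norm_real,
        Real.norm_eq_abs] at hlip
      have hd : |Real.exp s - ‖a‖| ≤ 2 * (δ * radialize τ a) :=
        (abs_sub_left_of_mem_uIcc (hexp s hs)).trans hza.le
      have hc2 := hL.c₂_pos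
      have hlow : τ ‖a‖ / 2 ≤ τ (Real.exp s) := by
        have h1 : c₂ * |Real.exp s - ‖a‖| ≤ c₂ * (2 * (δ * τ ‖a‖)) := by
          gcongr; exact hd
        have h2 := (abs_le.1 (hlip.trans h1)).1
        nlinarith
      set l := laplacian φ ((Real.exp s : ℝ) : ℂ) with hl
      have hpow : l ^ (-(1 / 2 : ℝ)) = (Real.sqrt l)⁻¹ := by
        rw [Real.rpow_neg hlp.le, Real.sqrt_eq_rpow]
      rw [hpow] at hcs
      have hsq : 0 < Real.sqrt l := Real.sqrt_pos.2 hlp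
      have h3 : τ ‖a‖ * Real.sqrt l ≤ 2 * C := by
        have : τ ‖a‖ / 2 / C ≤ (Real.sqrt l)⁻¹ := le_trans (by gcongr) hcs
        rw [le_inv_comm₀ (by positivity) hsq, div_div, inv_div, le_div_iff₀ hτ0] at this
        linarith
      have h4 : l ≤ 4 * C ^ 2 / τ ‖a‖ ^ 2 := by
        rw [le_div_iff₀ (by positivity)]
        have : (τ ‖a‖ * Real.sqrt l) ^ 2 ≤ (2 * C) ^ 2 := by gcongr
        rw [mul_pow, Real.sq_sqrt hlp.le] at this
        nlinarith
      rw [abs_of_nonneg (by positivity)]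
      calc Real.exp s ^ 2 * l ≤ 1 * l := by
            gcongr
            have := Real.exp_pos s
            nlinarith
        _ ≤ _ := by rw [one_mul]; exact h4)
  simp only [Real.exp_log hnz0] at hT
  have hphi : φ z = φ ((‖z‖ : ℝ) : ℂ) := hW.radial _ hzD _
    (by rw [mem_unitDisc, Complex.norm_real, norm_norm]; exact hz1)
    (by rw [Complex.norm_real, norm_norm])
  rw [hphi, Real.log_div hnz0.ne' hna.ne']
  refine hT.trans ?_
  have hlog : |Real.log ‖z‖ - Real.log ‖a‖| ≤ 8 * (δ * τ ‖a‖) := by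
    have key : ∀ x y : ℝ, 1 / 4 ≤ x → 1 / 4 ≤ y → Real.log x - Real.log y ≤ 4 * |x - y| := by
      intro x y hx hy
      have hx0 : 0 < x := by linarith
      have hy0 : 0 < y := by linarith
      rw [← Real.log_div hx0.ne' hy0.ne']
      refine (Real.log_le_sub_one_of_pos (by positivity)).trans ?_
      rw [div_sub_one hy0.ne', div_le_iff₀ hy0]
      nlinarith [le_abs_self (x - y), abs_nonneg (x - y)]
    have k1 := key ‖z‖ ‖a‖ hnz (by linarith)
    have k2 := key ‖a‖ ‖z‖ (by linarith) hnz
    rw [abs_sub_comm] at k2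
    have : 4 * |‖z‖ - ‖a‖| ≤ 8 * (δ * τ ‖a‖) := by
      have : |‖z‖ - ‖a‖| < 2 * (δ * τ ‖a‖) := hza
      linarith
    rw [abs_le]; constructor <;> linarith
  calc 4 * C ^ 2 / τ ‖a‖ ^ 2 * |Real.log ‖z‖ - Real.log ‖a‖| ^ 2
      ≤ 4 * C ^ 2 / τ ‖a‖ ^ 2 * (8 * (δ * τ ‖a‖)) ^ 2 := by gcongr
    _ = 256 * C ^ 2 * δ ^ 2 := by field_simp; ring
    _ ≤ 256 * C ^ 2 * (1 / 4) ^ 2 := by gcongr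
    _ = 16 * C ^ 2 := by ring

lemma weight_comp {ω φ : ℂ → ℝ} {τ : ℝ → ℝ} {c₁ c₂ δ : ℝ} (hW : IsClassW ω φ τ)
    (hL : IsClassL (radialize τ) c₁ c₂) (hδ : δ ∈ Set.Ioo 0 (mTau c₁ c₂)) :
    ∃ C : ℝ, 0 < C ∧ ∀ a ∈ unitDisc, ∃ h : ℂ → ℂ,
      DifferentiableOn ℂ h (Metric.ball a (2 * (δ * radialize τ a))) ∧
      ∀ z ∈ Metric.ball a (2 * (δ * radialize τ a)), ω z ≤ C * ‖h z‖ ^ 2 ∧ ‖h z‖ ^ 2 ≤ C * ω z := by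
  obtain ⟨C, hC, hcomp⟩ := hW.comp
  have hcb : Metric.closedBall (0:ℂ) (3/4) ⊆ unitDisc := Metric.closedBall_subset_ball (by norm_num)
  obtain ⟨B₀, hB₀⟩ := (isCompact_closedBall (0:ℂ) (3/4)).exists_bound_of_continuousOn
    (hW.smooth.continuousOn.mono hcb)
  set K := max B₀ (16 * C ^ 2) with hK
  -- it suffices to control the exponent
  have key : ∀ (z : ℂ) (u v : ℝ), z ∈ unitDisc → |φ z - u| ≤ K → v = Real.exp (-u) →
      ω z ≤ Real.exp (2 * K) * v ^ 2 ∧ v ^ 2 ≤ Real.exp (2 * K) * ω z := by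
    intro z u v hz hu hv
    rw [hW.omega_eq z hz, hv, ← Real.exp_nat_mul, ← Real.exp_add, ← Real.exp_add]
    have := abs_le.1 hu
    constructor <;> apply Real.exp_le_exp.2 <;> push_cast <;> linarith
  refine ⟨Real.exp (2 * K), Real.exp_pos _, fun a ha => ?_⟩
  obtain ⟨hρ0, hρ1⟩ := tau_radius hL hδ ha
  have hsub := ball_two_subset hL hδ ha
  by_cases ha2 : 1 / 2 ≤ ‖a‖
  · obtain ⟨A, B, hAB⟩ := phi_log_bound hW hL hδ hC (fun z hz => (hcomp z hz).1) ha ha2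
    have hna : 0 < ‖a‖ := by linarith
    have ha0 : a ≠ 0 := norm_pos_iff.1 hna
    refine ⟨fun z => Complex.exp (-(A + B * Complex.log (z / a))), ?_, fun z hz => ?_⟩
    · intro z hz
      rw [Metric.mem_ball, dist_eq_norm] at hz
      have hsl : z / a ∈ Complex.slitPlane := by
        have h1 : ‖z / a - 1‖ < 1 := by
          rw [div_sub_one ha0, norm_div, div_lt_one hna]; linarith
        have := Complex.mem_slitPlane_of_norm_lt_one h1
        simpa using this
      apply DifferentiableAt.differentiableWithinAt
      have hl : DifferentiableAt ℂ (fun z => Complex.log (z / a)) z :=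
        (differentiableAt_id.div_const a).clog hsl
      fun_prop
    · refine key z (A + B * Real.log (‖z‖ / ‖a‖)) _ (hsub hz)
        ((hAB z hz).trans (le_max_right _ _)) ?_
      rw [Complex.norm_exp]
      congr 1
      simp [Complex.log_re]
  · refine ⟨fun _ => 1, differentiableOn_const _, fun z hz => ?_⟩
    refine key z 0 _ (hsub hz) ?_ (by simp)
    rw [sub_zero]
    refine (hB₀ z ?_).trans (le_max_left _ _)
    rw [Metric.mem_ball, dist_eq_norm] at hz
    have : ‖z‖ ≤ ‖z - a‖ + ‖a‖ := by simpa using norm_add_le (z - a) a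
    rw [mem_closedBall_zero_iff]; linarith

/-- Interior estimate for a holomorphic function with a zero of order `n` at the center. -/
lemma zero_est {s h : ℂ → ℂ} {a : ℂ} {ρ J : ℝ} (hρ : 0 < ρ) (n : ℕ)
    (hs : DifferentiableOn ℂ s (Metric.ball a (2 * ρ)))
    (hh : DifferentiableOn ℂ h (Metric.ball a (2 * ρ))) (hJ : 0 ≤ J)
    (hI : ∫⁻ z in Metric.ball a (2 * ρ), ENNReal.ofReal (‖(z - a) ^ n * s z * h z‖ ^ 2) ∂dA ≤
      ENNReal.ofReal J) {z : ℂ} (hz : z ∈ Metric.ball a ρ) :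
    ‖(z - a) ^ n * s z * h z‖ ^ 2 ≤ (5 / 7) ^ (2 * n) * (J / (9 / 25 * ρ ^ 2)) := by
  set M := Real.sqrt (J / (9 / 25 * ρ ^ 2)) with hM
  have hM0 : 0 ≤ M := Real.sqrt_nonneg _
  have hM2 : M ^ 2 = J / (9 / 25 * ρ ^ 2) := Real.sq_sqrt (by positivity)
  have hp : DifferentiableOn ℂ (fun z => (z - a) ^ n * s z * h z) (Metric.ball a (2 * ρ)) := by
    refine DifferentiableOn.mul (DifferentiableOn.mul ?_ hs) hh
    fun_prop
  have hcirc : ∀ w, ‖w - a‖ = 7 / 5 * ρ → ‖s w * h w‖ ≤ M / (7 / 5 * ρ) ^ n := by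
    intro w hw
    have hsub : Metric.ball w (3 / 5 * ρ) ⊆ Metric.ball a (2 * ρ) := by
      apply Metric.ball_subset_ball'
      rw [dist_eq_norm, hw]; linarith
    have h1 := (submean (by positivity : 0 < 3 / 5 * ρ) (hp.mono hsub)).trans
      ((lintegral_mono_set hsub).trans hI)
    rw [ENNReal.ofReal_le_ofReal_iff hJ] at h1
    have h2 : ‖(w - a) ^ n * s w * h w‖ ≤ M := by
      apply Real.le_sqrt_of_sq_le
      rw [le_div_iff₀ (by positivity)]
      calc _ = (3 / 5 * ρ) ^ 2 * ‖(w - a) ^ n * s w * h w‖ ^ 2 := by ring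
        _ ≤ _ := h1
    rw [mul_assoc, norm_mul, norm_pow, hw] at h2
    rw [le_div_iff₀ (by positivity)]
    linarith
  have hmax : ‖s z * h z‖ ≤ M / (7 / 5 * ρ) ^ n := by
    refine Complex.norm_le_of_forall_mem_frontier_norm_le (f := fun z => s z * h z)
      (U := Metric.ball a (7 / 5 * ρ)) Metric.isBounded_ball ?_ ?_ ?_
    · apply DifferentiableOn.diffContOnCl
      rw [closure_ball _ (by positivity)]
      exact (hs.mul hh).mono (Metric.closedBall_subset_ball (by linarith))
    · intro w hw
      rw [frontier_ball _ (by positivity), mem_sphere_iff_norm] at hw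
      exact hcirc w hw
    · exact subset_closure (Metric.ball_subset_ball (by linarith) hz)
  rw [Metric.mem_ball, dist_eq_norm] at hz
  have h3 : ‖(z - a) ^ n * s z * h z‖ ≤ (5 / 7) ^ n * M := by
    rw [mul_assoc, norm_mul, norm_pow]
    calc ‖z - a‖ ^ n * ‖s z * h z‖ ≤ ρ ^ n * (M / (7 / 5 * ρ) ^ n) := by gcongr
      _ = (ρ / (7 / 5 * ρ)) ^ n * M := by rw [div_pow]; ring
      _ = _ := by congr 2; field_simp
  calc _ ≤ ((5 / 7) ^ n * M) ^ 2 := by gcongr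
    _ = _ := by rw [mul_pow, hM2, ← pow_mul, mul_comm n]

lemma local_est {ω φ : ℂ → ℝ} {τ : ℝ → ℝ} {c₁ c₂ δ : ℝ} (hW : IsClassW ω φ τ)
    (hL : IsClassL (radialize τ) c₁ c₂) (hδ : δ ∈ Set.Ioo 0 (mTau c₁ c₂)) :
    ∃ C : ℝ, 0 < C ∧ ∀ a ∈ unitDisc, ∀ (n : ℕ) (q : Polynomial ℂ),
      (Polynomial.X - Polynomial.C a) ^ n ∣ q → ∀ z ∈ Metric.ball a (δ * radialize τ a),
      ENNReal.ofReal (‖q.eval z‖ ^ 2 * ω z) ≤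
        ENNReal.ofReal (C * (5 / 7) ^ (2 * n)) * ((ENNReal.ofReal ((δ * radialize τ a) ^ 2))⁻¹ *
          ∫⁻ w in Metric.ball a (2 * (δ * radialize τ a)), ENNReal.ofReal (‖q.eval w‖ ^ 2 * ω w) ∂dA) := by
  obtain ⟨C, hC, hcomp⟩ := weight_comp hW hL hδ
  refine ⟨C * C * (25 / 9), by positivity, ?_⟩
  rintro a ha n q ⟨s, rfl⟩ z hz
  obtain ⟨h, hh, hcmp⟩ := hcomp a ha
  obtain ⟨hρ0, hρ1⟩ := tau_radius hL hδ ha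
  have hsub := ball_two_subset hL hδ ha
  set ρ := δ * radialize τ a with hρ
  have heval : ∀ w, ((Polynomial.X - Polynomial.C a) ^ n * s).eval w = (w - a) ^ n * s.eval w := by
    intro w; simp
  simp only [heval]
  set I := ∫⁻ w in Metric.ball a (2 * ρ), ENNReal.ofReal (‖(w - a) ^ n * s.eval w‖ ^ 2 * ω w) ∂dA with hI
  by_cases hIt : I = ⊤
  · rw [hIt, ENNReal.mul_top (by simp), ENNReal.mul_top]
    · exact le_top
    · simp only [ne_eq, ENNReal.ofReal_eq_zero, not_le]; positivity
  have hIJ : I = ENNReal.ofReal I.toReal := (ENNReal.ofReal_toReal hIt).symm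
  have hz2 : z ∈ Metric.ball a (2 * ρ) := Metric.ball_subset_ball (by linarith) hz
  have hest := zero_est (s := fun w => s.eval w) (h := h) (J := C * I.toReal) hρ0 n
    (s.differentiable.differentiableOn) hh (by positivity) (by
      rw [ENNReal.ofReal_mul hC.le, ← hIJ, hI, ← lintegral_const_mul' _ _ ENNReal.ofReal_ne_top]
      refine setLIntegral_mono' measurableSet_ball fun w hw => ?_
      rw [← ENNReal.ofReal_mul hC.le]
      apply ENNReal.ofReal_le_ofReal
      rw [norm_mul, mul_pow]
      nlinarith [(hcmp w hw).2, sq_nonneg ‖(w - a) ^ n * s.eval w‖]) hz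
  rw [hIJ, ← ENNReal.ofReal_inv_of_pos (by positivity), ← ENNReal.ofReal_mul (by positivity),
    ← ENNReal.ofReal_mul (by positivity)]
  apply ENNReal.ofReal_le_ofReal
  calc _ ≤ ‖(z - a) ^ n * s.eval z‖ ^ 2 * (C * ‖h z‖ ^ 2) := by
        gcongr; exact (hcmp z hz2).1
    _ = C * ‖(z - a) ^ n * s.eval z * h z‖ ^ 2 := by rw [norm_mul _ (h z)]; ring
    _ ≤ C * ((5 / 7) ^ (2 * n) * (C * I.toReal / (9 / 25 * ρ ^ 2))) := by gcongr
    _ = _ := by field_simp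

lemma overlap {τ : ℝ → ℝ} {c₁ c₂ δ : ℝ} (hL : IsClassL (radialize τ) c₁ c₂)
    (hδ : δ ∈ Set.Ioo 0 (mTau c₁ c₂)) {z : ℕ → ℂ} (hz : IsLattice (radialize τ) δ z)
    {f : ℂ → ℝ≥0∞} (hf : AEMeasurable f (dA.restrict unitDisc)) :
    ∑' j, ∫⁻ w in Metric.ball (z j) (2 * (δ * radialize τ (z j))), f w ∂dA ≤
      1849 * ∫⁻ w in unitDisc, f w ∂dA := by
  classical
  have hsub := fun j => ball_two_subset hL hδ (hz.mem j)
  have h1 : ∀ j, ∫⁻ w in Metric.ball (z j) (2 * (δ * radialize τ (z j))), f w ∂dA =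
      ∫⁻ w in unitDisc, (Metric.ball (z j) (2 * (δ * radialize τ (z j)))).indicator f w ∂dA := by
    intro j
    rw [lintegral_indicator measurableSet_ball, Measure.restrict_restrict measurableSet_ball,
      inter_eq_left.2 (hsub j)]
  simp_rw [h1]
  rw [← lintegral_tsum (fun j => hf.indicator measurableSet_ball),
    ← lintegral_const_mul'' _ hf]
  refine setLIntegral_mono' isOpen_unitDisc.measurableSet fun w hw => ?_
  rw [ENNReal.tsum_eq_iSup_sum]
  refine iSup_le fun t => ?_
  simp only [indicator_apply]
  rw [← Finset.sum_filter, Finset.sum_const, nsmul_eq_mul]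
  gcongr
  have := lattice_mult hL hδ z hz.mem hz.sep w hw
    (t.filter fun j => w ∈ Metric.ball (z j) (2 * (δ * radialize τ (z j)))) (by
      intro j hj
      refine Metric.ball_subset_ball ?_ (Finset.mem_filter.1 hj).2
      have := (tau_radius hL hδ (hz.mem j)).1
      linarith)
  exact_mod_cast this

lemma sum_est {ω φ : ℂ → ℝ} {τ : ℝ → ℝ} {c₁ c₂ δ : ℝ} (hW : IsClassW ω φ τ)
    (hL : IsClassL (radialize τ) c₁ c₂) (hδ : δ ∈ Set.Ioo 0 (mTau c₁ c₂))
    {z : ℕ → ℂ} (hz : IsLattice (radialize τ) δ z) :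
    ∃ C : ℝ, 0 < C ∧ ∀ (u : ℂ → ℂ) (_ : AEStronglyMeasurable u (volume.restrict unitDisc))
      (n : ℕ → ℕ) (q : Polynomial ℂ) (_ : ∀ j, (Polynomial.X - Polynomial.C (z j)) ^ n j ∣ q)
      (c : ℝ≥0∞) (_ : ∀ j, ENNReal.ofReal ((5 / 7) ^ (2 * n j)) * localMeanE (radialize τ) δ u (z j) ≤ c),
      ∫⁻ w, ENNReal.ofReal (‖u w * q.eval w‖ ^ 2) ∂(muW ω) ≤
        ENNReal.ofReal C * c * ∫⁻ w, ENNReal.ofReal (‖q.eval w‖ ^ 2) ∂(muW ω) := by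
  obtain ⟨C, hC, hloc⟩ := local_est hW hL hδ
  refine ⟨C * 1849, by positivity, fun u hu n q hq c hc => ?_⟩
  have hqc : Continuous fun w => q.eval w := q.continuous
  have hun : AEMeasurable (fun w => ENNReal.ofReal (‖u w‖ ^ 2)) (dA.restrict unitDisc) := by
    have : AEMeasurable (fun w => ENNReal.ofReal (‖u w‖ ^ 2)) (volume.restrict unitDisc) :=
      (hu.norm.aemeasurable.pow_const 2).ennreal_ofReal
    unfold dA
    rw [Measure.restrict_smul]
    exact this.smul_measure _
  have hqm : AEMeasurable (fun w => ENNReal.ofReal (‖q.eval w‖ ^ 2 * ω w)) (dA.restrict unitDisc) := by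
    have h1 : ContinuousOn (fun w => ‖q.eval w‖ ^ 2 * ω w) unitDisc :=
      (hqc.norm.pow 2).continuousOn.mul (omega_continuousOn hW)
    exact (h1.aemeasurable isOpen_unitDisc.measurableSet).ennreal_ofReal
  have hum : AEMeasurable (fun w => ENNReal.ofReal (‖u w * q.eval w‖ ^ 2)) (volume.restrict unitDisc) :=
    ((hu.mul hqc.aestronglyMeasurable).norm.aemeasurable.pow_const 2).ennreal_ofReal
  have hqm2 : AEMeasurable (fun w => ENNReal.ofReal (‖q.eval w‖ ^ 2)) (volume.restrict unitDisc) :=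
    (hqc.norm.pow 2).aemeasurable.ennreal_ofReal
  rw [lintegral_muW hW hum, lintegral_muW hW hqm2]
  have e1 : ∀ w ∈ unitDisc, ENNReal.ofReal (ω w) * ENNReal.ofReal (‖u w * q.eval w‖ ^ 2) =
      ENNReal.ofReal (‖u w‖ ^ 2) * ENNReal.ofReal (‖q.eval w‖ ^ 2 * ω w) := by
    intro w hw
    rw [← ENNReal.ofReal_mul (hW.pos w hw).le, ← ENNReal.ofReal_mul (by positivity), norm_mul]
    congr 1; ring
  have e2 : ∀ w ∈ unitDisc, ENNReal.ofReal (ω w) * ENNReal.ofReal (‖q.eval w‖ ^ 2) =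
      ENNReal.ofReal (‖q.eval w‖ ^ 2 * ω w) := by
    intro w hw
    rw [← ENNReal.ofReal_mul (hW.pos w hw).le, mul_comm]
  rw [setLIntegral_congr_fun isOpen_unitDisc.measurableSet e1,
    setLIntegral_congr_fun isOpen_unitDisc.measurableSet e2]
  have hcov : unitDisc ⊆ ⋃ j, Metric.ball (z j) (δ * radialize τ (z j)) := fun w hw =>
    mem_iUnion.2 (hz.covers w hw)
  refine (lintegral_mono_set hcov).trans ((lintegral_iUnion_le _ _).trans ?_)
  have hstep : ∀ j, ∫⁻ w in Metric.ball (z j) (δ * radialize τ (z j)),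
      ENNReal.ofReal (‖u w‖ ^ 2) * ENNReal.ofReal (‖q.eval w‖ ^ 2 * ω w) ∂dA ≤
      ENNReal.ofReal C * c * ∫⁻ w in Metric.ball (z j) (2 * (δ * radialize τ (z j))),
        ENNReal.ofReal (‖q.eval w‖ ^ 2 * ω w) ∂dA := by
    intro j
    have hρ := (tau_radius hL hδ (hz.mem j)).1
    have hsub : Metric.ball (z j) (δ * radialize τ (z j)) ⊆ unitDisc :=
      (Metric.ball_subset_ball (by linarith)).trans (ball_two_subset hL hδ (hz.mem j))
    refine (setLIntegral_mono' measurableSet_ball fun w hw =>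
      mul_le_mul' le_rfl (hloc (z j) (hz.mem j) (n j) q (hq j) w hw)).trans ?_
    rw [lintegral_mul_const'' _ (hun.mono_measure (Measure.restrict_mono hsub le_rfl))]
    calc _ = ENNReal.ofReal C * (ENNReal.ofReal ((5 / 7) ^ (2 * n j)) *
            localMeanE (radialize τ) δ u (z j)) *
            ∫⁻ w in Metric.ball (z j) (2 * (δ * radialize τ (z j))),
              ENNReal.ofReal (‖q.eval w‖ ^ 2 * ω w) ∂dA := by
          unfold localMeanE
          rw [ENNReal.ofReal_mul hC.le]
          ring
      _ ≤ _ := mul_le_mul' (mul_le_mul' le_rfl (hc j)) le_rfl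
  refine (ENNReal.tsum_le_tsum hstep).trans ?_
  rw [ENNReal.tsum_mul_left]
  refine (mul_le_mul' le_rfl (overlap hL hδ hz hqm)).trans (le_of_eq ?_)
  rw [ENNReal.ofReal_mul hC.le, show ENNReal.ofReal 1849 = 1849 by simp]
  ring

lemma mul_Lp_est {ω φ : ℂ → ℝ} {τ : ℝ → ℝ} {c₁ c₂ δ : ℝ} (hW : IsClassW ω φ τ)
    (hL : IsClassL (radialize τ) c₁ c₂) (hδ : δ ∈ Set.Ioo 0 (mTau c₁ c₂))
    {z : ℕ → ℂ} (hz : IsLattice (radialize τ) δ z) :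
    ∃ K : ℝ, 0 < K ∧ ∀ (u : ℂ → ℂ) (_ : AEStronglyMeasurable u (volume.restrict unitDisc))
      (_ : ∀ j, localMeanE (radialize τ) δ u (z j) ≠ ⊤)
      (n : ℕ → ℕ) (q : Polynomial ℂ) (_ : ∀ j, (Polynomial.X - Polynomial.C (z j)) ^ n j ∣ q)
      (c : ℝ) (_ : 0 ≤ c)
      (_ : ∀ j, (5 / 7) ^ n j * Real.sqrt (localMeanE (radialize τ) δ u (z j)).toReal ≤ c),
      ∃ U : Lp ℂ 2 (muW ω), (U : ℂ → ℂ) =ᵐ[muW ω] (fun w => u w * q.eval w) ∧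
        ‖U‖ ≤ K * c * ‖polyH hW q‖ := by
  obtain ⟨C, hC, hest⟩ := sum_est hW hL hδ hz
  refine ⟨Real.sqrt C, Real.sqrt_pos.2 hC, fun u hu hfin n q hq c hc0 hc => ?_⟩
  have h1 := hest u hu n q hq (ENNReal.ofReal (c ^ 2)) (by
    intro j
    rw [← ENNReal.ofReal_toReal (hfin j), ← ENNReal.ofReal_mul (by positivity)]
    apply ENNReal.ofReal_le_ofReal
    have : ((5 / 7) ^ n j * Real.sqrt (localMeanE (radialize τ) δ u (z j)).toReal) ^ 2 ≤ c ^ 2 :=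
      pow_le_pow_left₀ (by positivity) (hc j) 2
    rw [mul_pow, Real.sq_sqrt ENNReal.toReal_nonneg, ← pow_mul, mul_comm (n j)] at this
    exact this)
  have hInteg : Integrable (fun w => ‖q.eval w‖ ^ 2) (muW ω) := (poly_memLp hW q).integrable_norm_pow (by norm_num)
  have hnorm : ‖polyH hW q‖ ^ 2 = ∫ w, ‖q.eval w‖ ^ 2 ∂(muW ω) := by
    rw [norm_polyH]; exact normSq_Lp _ (polyLp_ae hW q)
  rw [← ofReal_integral_eq_lintegral_ofReal hInteg (ae_of_all _ fun w => by positivity), ← hnorm,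
    ← ENNReal.ofReal_mul hC.le, ← ENNReal.ofReal_mul (by positivity)] at h1
  have hum : AEStronglyMeasurable (fun w => u w * q.eval w) (muW ω) := by
    rw [aesm_muW_iff hW]; exact hu.mul q.continuous.aestronglyMeasurable
  have hInteg2 : Integrable (fun w => ‖u w * q.eval w‖ ^ 2) (muW ω) := by
    refine ⟨hum.norm.pow 2, ?_⟩
    rw [hasFiniteIntegral_iff_ofReal (ae_of_all _ fun w => by positivity)]
    exact h1.trans_lt ENNReal.ofReal_lt_top
  have hmem : MemLp (fun w => u w * q.eval w) 2 (muW ω) :=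
    (memLp_two_iff_integrable_sq_norm hum).2 hInteg2
  refine ⟨hmem.toLp, hmem.coeFn_toLp, ?_⟩
  have h2 := normSq_Lp _ hmem.coeFn_toLp
  rw [← ofReal_integral_eq_lintegral_ofReal hInteg2 (ae_of_all _ fun w => by positivity), ← h2,
    ENNReal.ofReal_le_ofReal_iff (by positivity)] at h1
  refine (sq_le_sq₀ (norm_nonneg _) (by positivity)).1 (h1.trans (le_of_eq ?_))
  rw [mul_pow, mul_pow, Real.sq_sqrt hC.le]

lemma count_down {b : ℕ × ℕ → ℝ} {t : ℝ} (hf : {i | t < b i}.Finite)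
    (hanti : ∀ j, Antitone fun n => b (j, n)) (j : ℕ) :
    b (j, (hf.toFinset.filter fun i => i.1 = j).card) ≤ t := by
  by_contra hcon
  push Not at hcon
  set N := (hf.toFinset.filter fun i => i.1 = j).card with hN
  have hsub : (Finset.range (N + 1)).image (fun n => (j, n)) ⊆ hf.toFinset.filter fun i => i.1 = j := by
    intro i hi
    obtain ⟨n, hn, rfl⟩ := Finset.mem_image.1 hi
    simp only [Finset.mem_filter, Finite.mem_toFinset, mem_setOf_eq, and_true]
    exact hcon.trans_le (hanti j (Nat.lt_succ_iff.1 (Finset.mem_range.1 hn)))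
  have := Finset.card_le_card hsub
  rw [Finset.card_image_of_injective _ (fun a b h => (Prod.mk.inj h).2), Finset.card_range] at this
  omega

lemma summable_of_tsum {A : ℕ → ℝ≥0∞} {p : ℝ} (hp : 0 < p) (h : ∑' j, A j ^ (p / 2) < ⊤) :
    (∀ j, A j ≠ ⊤) ∧ Summable fun j => Real.sqrt (A j).toReal ^ p := by
  constructor
  · intro j hj
    have := ENNReal.ne_top_of_tsum_ne_top h.ne j
    rw [hj, ENNReal.top_rpow_of_pos (by positivity)] at this
    exact this rfl
  · refine (ENNReal.summable_toReal h.ne).congr fun j => ?_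
    rw [← ENNReal.toReal_rpow, Real.sqrt_eq_rpow, ← Real.rpow_mul ENNReal.toReal_nonneg]
    congr 1; ring

theorem stmt2 (ω φ : ℂ → ℝ) (τ : ℝ → ℝ) (c₁ c₂ : ℝ)
    (hW : IsClassW ω φ τ) (hL : IsClassL (radialize τ) c₁ c₂)
    (g : ℂ → ℂ) (hg : MemLp g 2 (muW ω))
    (T : bergmanH ω →L[ℂ] Lp ℂ 2 (muW ω)) (hT : IsHankelExtension ω g T)
    (p : ℝ) (hp : p ∈ Set.Ioo (0 : ℝ) 1)
    (hcond : SchattenCondThree (radialize τ) φ c₁ c₂ g p) :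
    MemSchatten p T := by
  classical
  obtain ⟨δ, hδ, g₁, g₂, hgg, hg₂, hsum⟩ := hcond
  obtain ⟨z, hz⟩ := exists_lattice hL hW.tau_anti hδ
  obtain ⟨hA, hB⟩ := hsum z hz
  obtain ⟨hAf, hAs⟩ := summable_of_tsum hp.1 hA
  obtain ⟨hBf, hBs⟩ := summable_of_tsum hp.1 hB
  set h : ℂ → ℂ := fun w => dbar g₂ w / (Real.sqrt (laplacian φ w) : ℂ) with hh
  set α : ℕ → ℝ := fun j => Real.sqrt (localMeanE (radialize τ) δ g₁ (z j)).toReal with hα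
  set β : ℕ → ℝ := fun j => Real.sqrt (localMeanE (radialize τ) δ h (z j)).toReal with hβ
  have hα0 : ∀ j, 0 ≤ α j := fun j => Real.sqrt_nonneg _
  have hβ0 : ∀ j, 0 ≤ β j := fun j => Real.sqrt_nonneg _
  obtain ⟨K, hK, hest⟩ := mul_Lp_est hW hL hδ hz
  -- measurability
  have hD := isOpen_unitDisc.measurableSet
  have hg₁m : AEStronglyMeasurable g₁ (volume.restrict unitDisc) := by
    have h1 : AEStronglyMeasurable g (volume.restrict unitDisc) := (aesm_muW_iff hW).1 hg.1
    refine (h1.sub (hg₂.continuousOn.aestronglyMeasurable hD)).congr ?_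
    filter_upwards [ae_restrict_mem hD] with w hw
    simp [hgg w hw]
  have hhm : AEStronglyMeasurable h (volume.restrict unitDisc) := by
    refine ContinuousOn.aestronglyMeasurable ?_ hD
    refine (dbar_continuousOn hg₂).div
      (Complex.continuous_ofReal.comp_continuousOn (laplacian_continuousOn hW.smooth).sqrt) ?_
    intro w hw
    exact_mod_cast (Real.sqrt_pos.2 (hW.lap_pos w hw)).ne'
  -- norm estimate on multiples
  set K1 := K + Real.sqrt 2 * K with hK1
  have hK1p : 0 < K1 := by positivity
  have hmain : ∀ (n : ℕ → ℕ) (q : Polynomial ℂ)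
      (_ : ∀ j, (Polynomial.X - Polynomial.C (z j)) ^ n j ∣ q) (c : ℝ) (_ : 0 ≤ c)
      (_ : ∀ j, (5 / 7) ^ n j * (α j + β j) ≤ c), ‖T (polyH hW q)‖ ≤ K1 * c * ‖polyH hW q‖ := by
    intro n q hq c hc0 hc
    obtain ⟨G1, hG1, hG1n⟩ := hest g₁ hg₁m hAf n q hq c hc0 (fun j => le_trans (by
      gcongr; exact le_add_of_nonneg_right (hβ0 j)) (hc j))
    obtain ⟨H, hH, hHn⟩ := hest h hhm hBf n q hq c hc0 (fun j => le_trans (by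
      gcongr; exact le_add_of_nonneg_left (hα0 j)) (hc j))
    obtain ⟨M, hM⟩ := poly_bdd q
    have hgq : MemLp (fun w => g w * q.eval w) 2 (muW ω) := by
      refine MemLp.of_le_mul (c := M) hg (hg.1.mul q.continuous.aestronglyMeasurable) ?_
      filter_upwards [mem_unitDisc_ae hW] with w hw
      rw [norm_mul, mul_comm]
      gcongr
      exact hM w hw
    have hTq := hT (polyH hW q) (fun w => q.eval w) M q.differentiable.differentiableOn hM
      (polyLp_ae hW q) hgq.toLp hgq.coeFn_toLp
    rw [hTq]
    refine (hankel_bound hW hgg hg₂ q hgq.coeFn_toLp hG1 hH).trans ?_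
    have : Real.sqrt 2 * ‖H‖ ≤ Real.sqrt 2 * (K * c * ‖polyH hW q‖) := by gcongr
    calc _ ≤ K * c * ‖polyH hW q‖ + Real.sqrt 2 * (K * c * ‖polyH hW q‖) := add_le_add hG1n this
      _ = _ := by rw [hK1]; ring
  -- conclusion by rearrangement
  unfold MemSchatten
  set b : ℕ × ℕ → ℝ := fun i => (α i.1 + β i.1) * (K1 * (5 / 7) ^ i.2) with hb
  refine summable_rearrange _ (singularNumber_nonneg T) (singularNumber_antitone T) b
    (fun i => mul_nonneg (add_nonneg (hα0 _) (hβ0 _)) (by positivity)) p hp.1 ?_ ?_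
  · have hs1 : Summable fun j => (α j + β j) ^ p := by
      refine Summable.of_nonneg_of_le (fun j => Real.rpow_nonneg (add_nonneg (hα0 _) (hβ0 _)) _)
        (fun j => Real.rpow_add_le_add_rpow (hα0 j) (hβ0 j) hp.1.le hp.2.le) (hAs.add hBs)
    have hs2 : Summable fun n : ℕ => (K1 * (5 / 7 : ℝ) ^ n) ^ p := by
      have : Summable fun n : ℕ => K1 ^ p * ((5 / 7 : ℝ) ^ p) ^ n :=
        (summable_geometric_of_lt_one (by positivity)
          (Real.rpow_lt_one (by norm_num) (by norm_num) hp.1)).mul_left _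
      refine this.congr fun n => ?_
      rw [Real.mul_rpow hK1p.le (by positivity), ← Real.rpow_natCast, ← Real.rpow_natCast,
        ← Real.rpow_mul (by norm_num), ← Real.rpow_mul (by norm_num), mul_comm p]
    refine (hs1.mul_of_nonneg hs2 (fun j => Real.rpow_nonneg (add_nonneg (hα0 _) (hβ0 _)) _)
      (fun n => by positivity)).congr fun i => ?_
    rw [hb, Real.mul_rpow (add_nonneg (hα0 _) (hβ0 _)) (by positivity)]
  · intro t ht hf
    set n : ℕ → ℕ := fun j => (hf.toFinset.filter fun i => i.1 = j).card with hn
    set J := hf.toFinset.image Prod.fst with hJ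
    set q : Polynomial ℂ := ∏ j ∈ J, (Polynomial.X - Polynomial.C (z j)) ^ n j with hq
    have hqm : q.Monic := Polynomial.monic_prod_of_monic _ _ fun j _ => (Polynomial.monic_X_sub_C _).pow _
    have hdeg : q.natDegree = hf.toFinset.card := by
      rw [hq, Polynomial.natDegree_prod_of_monic _ _ fun j _ => (Polynomial.monic_X_sub_C _).pow _,
        Finset.card_eq_sum_card_image Prod.fst]
      refine Finset.sum_congr rfl fun j _ => ?_
      rw [Polynomial.natDegree_pow, Polynomial.natDegree_X_sub_C, mul_one]
    have hdvd : ∀ j, (Polynomial.X - Polynomial.C (z j)) ^ n j ∣ q := by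
      intro j
      by_cases hj : j ∈ J
      · exact Finset.dvd_prod_of_mem _ hj
      · have : n j = 0 := by
          rw [hn, Finset.card_eq_zero, Finset.filter_eq_empty_iff]
          intro i hi hij
          exact hj (Finset.mem_image.2 ⟨i, hi, hij⟩)
        rw [this, pow_zero]; exact one_dvd _
    have hdown := count_down hf (fun j => by
      intro m m' hmm
      simp only [hb]
      have := add_nonneg (hα0 j) (hβ0 j)
      gcongr ?_ * (_ * ?_)
      exact pow_le_pow_of_le_one (by norm_num) (by norm_num) hmm)
    rw [← hdeg]
    refine singularNumber_le_of_polynomial T (polyH hW) (poly_dense hW) q hqm t ht.le fun a => ?_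
    have := hmain n (q * a) (fun j => (hdvd j).mul_right a) (t / K1) (by positivity) (fun j => by
      have := hdown j
      simp only [hb] at this
      rw [le_div_iff₀ hK1p]
      calc _ = (α j + β j) * (K1 * (5 / 7) ^ n j) := by ring
        _ ≤ t := this)
    rwa [mul_div_cancel₀ _ hK1p.ne'] at this

end
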